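/- For every s with 1 ≤ s ≤ ∞ there exist a probability space (X,ℬ,μ) and a measure-preserving ℤ²-action α on it with order of mixing M(α) = 1 and shape order of mixing S(α) = s. -/

import Mathlib

open MeasureTheory Filter Topology

noncomputable section

/-- A sequence of `r`-tuples of vectors in `ℤ^d` moves apart if all pairwise
differences tend to infinity in norm. -/
def MovesApart {d r : ℕ} (n : ℕ → Fin r → (Fin d → ℤ)) : Prop :=
  ∀ s t : Fin r, s ≠ t → Tendsto (fun j => ‖n j s - n j t‖) atTop atTop

/-- A `ℤ^d`-action `α` on a measure space is mixing of order `r` (`r`-mixing). -/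
def IsMixingOfOrder {X : Type*} [MeasurableSpace X] {d : ℕ}
    (μ : Measure X) (α : (Fin d → ℤ) → X → X) (r : ℕ) : Prop :=
  ∀ n : ℕ → Fin r → (Fin d → ℤ), MovesApart n →
    ∀ A : Fin r → Set X, (∀ i, MeasurableSet (A i)) →
      Tendsto (fun j => μ (⋂ i, α (n j i) ⁻¹' A i)) atTop (𝓝 (∏ i, μ (A i)))

/-- The order of mixing `M(α)`: the supremum of all `r` for which `α` is `r`-mixing. -/
def mixingOrder {X : Type*} [MeasurableSpace X] {d : ℕ}
    (μ : Measure X) (α : (Fin d → ℤ) → X → X) : ℕ∞ :=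
  sSup ((↑) '' {r : ℕ | IsMixingOfOrder μ α r})

/-- The finite set `{n 0, …, n (r-1)}` (enumerated injectively) is a mixing shape
for `α`. -/
def IsMixingShape {X : Type*} [MeasurableSpace X] {d : ℕ}
    (μ : Measure X) (α : (Fin d → ℤ) → X → X) {r : ℕ}
    (n : Fin r → (Fin d → ℤ)) : Prop :=
  ∀ A : Fin r → Set X, (∀ i, MeasurableSet (A i)) →
    Tendsto (fun k : ℕ => μ (⋂ i, α ((k : ℤ) • n i) ⁻¹' A i)) atTop (𝓝 (∏ i, μ (A i)))

/-- The shape order of mixing `S(α)`: the supremum of all `r` such that every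
`r`-element subset of `ℤ^d` is a mixing shape for `α`. -/
def shapeMixingOrder {X : Type*} [MeasurableSpace X] {d : ℕ}
    (μ : Measure X) (α : (Fin d → ℤ) → X → X) : ℕ∞ :=
  sSup ((↑) '' {r : ℕ | ∀ n : Fin r → (Fin d → ℤ), Function.Injective n →
    IsMixingShape μ α n})

/-- A measure-preserving `ℤ^d`-action on a probability space. -/
structure MPSystem (d : ℕ) : Type 1 where
  (X : Type)
  [msp : MeasurableSpace X]
  (μ : MeasureTheory.Measure X)
  [prob : MeasureTheory.IsProbabilityMeasure μ]
  (act : (Fin d → ℤ) → X → X)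
  (act_zero : act 0 = id)
  (act_add : ∀ m n : Fin d → ℤ, act (m + n) = act m ∘ act n)
  (mp : ∀ n : Fin d → ℤ, MeasureTheory.MeasurePreserving (act n) μ μ)

attribute [instance] MPSystem.msp MPSystem.prob

/-- The order of mixing of a measure-preserving system. -/
def MPSystem.mixOrder {d : ℕ} (A : MPSystem d) : ℕ∞ := mixingOrder A.μ A.act

/-- The shape order of mixing of a measure-preserving system. -/
def MPSystem.shapeOrder {d : ℕ} (A : MPSystem d) : ℕ∞ := shapeMixingOrder A.μ A.act

/-! ### Random sign characters of an abelian group -/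

instance : MeasurableSingletonClass ℤˣ where
  measurableSet_singleton a := by
    have : ({a} : Set ℤˣ) = Units.val ⁻¹' {(a : ℤ)} := by
      ext b; simp [Units.ext_iff]
    rw [this]
    exact ⟨_, MeasurableSet.singleton _, rfl⟩

instance : Countable ℤˣ := Finite.to_countable

/-- The real number underlying a sign. -/
def signVal (a : ℤˣ) : ℝ := ((a : ℤ) : ℝ)

@[simp] lemma signVal_one : signVal 1 = 1 := by simp [signVal]

lemma signVal_mul (a b : ℤˣ) : signVal (a * b) = signVal a * signVal b := by simp [signVal]

lemma signVal_prod {ι : Type*} (s : Finset ι) (a : ι → ℤˣ) :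
    signVal (∏ i ∈ s, a i) = ∏ i ∈ s, signVal (a i) := by
  simp [signVal, Units.coe_prod]

lemma signVal_eq_or (a : ℤˣ) : signVal a = 1 ∨ signVal a = -1 := by
  rcases Int.units_eq_one_or a with rfl | rfl <;> simp [signVal]

lemma abs_signVal (a : ℤˣ) : |signVal a| = 1 := by
  rcases signVal_eq_or a with h | h <;> simp [h]

lemma measurable_signVal : Measurable signVal := .of_discrete

lemma integrable_signVal {Ω : Type*} [MeasurableSpace Ω] {P : Measure Ω} [IsFiniteMeasure P]
    {ξ : Ω → ℤˣ} (hξ : Measurable ξ) : Integrable (fun ω => signVal (ξ ω)) P :=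
  .of_bound (measurable_signVal.comp hξ).aestronglyMeasurable 1
    (.of_forall fun _ => (abs_signVal _).le)

lemma prod_indicator_preimage {ι X Y : Type*} [Fintype ι] (T : ι → X → Y) (S : ι → Set Y) (x : X) :
    ∏ i, (S i).indicator (fun _ => (1 : ℝ)) (T i x) =
      (⋂ i, T i ⁻¹' S i).indicator (fun _ => (1 : ℝ)) x := by
  by_cases h : ∀ i, T i x ∈ S i
  · rw [Set.indicator_of_mem (Set.mem_iInter.2 h)]
    exact Finset.prod_eq_one fun i _ => Set.indicator_of_mem (h i) _
  · rw [Set.indicator_of_notMem fun hx => h (Set.mem_iInter.1 hx)]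
    obtain ⟨i, hi⟩ := not_forall.1 h
    exact Finset.prod_eq_zero (Finset.mem_univ i) (Set.indicator_of_notMem hi _)

/-- The space of sign characters of an abelian group. -/
abbrev SignDual (V : Type) [AddCommGroup V] : Type :=
  {x : V → ℤˣ // ∀ v w, x (v + w) = x v * x w}

/-- `c` is the expectation of a random sign character of `V`. -/
def IsSignMean {V : Type} [AddCommGroup V] (c : V → ℝ) : Prop :=
  ∃ (Ω : Type) (_ : MeasurableSpace Ω) (P : Measure Ω) (_ : IsProbabilityMeasure P)
    (ξ : V → Ω → ℤˣ), (∀ v, Measurable (ξ v)) ∧ (∀ v w ω, ξ (v + w) ω = ξ v ω * ξ w ω) ∧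
      ∀ v, ∫ ω, signVal (ξ v ω) ∂P = c v

namespace SignDual

variable {V : Type} [AddCommGroup V]

/-- Evaluation of sign characters at `v`, as a real function. -/
def eval (v : V) (x : SignDual V) : ℝ := signVal (x.1 v)

lemma map_zero (x : SignDual V) : x.1 0 = 1 := by
  have := x.2 0 0
  rw [add_zero] at this
  exact (mul_eq_left.1 this.symm)

lemma eval_zero : eval (0 : V) = 1 := by
  funext x; simp [eval, map_zero]

lemma eval_add (v w : V) : eval (v + w) = eval v * eval w := by
  funext x; simp [eval, x.2, signVal_mul]

lemma eval_sum {ι : Type*} (s : Finset ι) (v : ι → V) (x : SignDual V) :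
    eval (∑ i ∈ s, v i) x = ∏ i ∈ s, eval (v i) x := by
  classical
  induction s using Finset.induction_on with
  | empty => simp [eval_zero]
  | insert a s ha ih => rw [Finset.sum_insert ha, Finset.prod_insert ha, eval_add, Pi.mul_apply, ih]

lemma measurable_coord (v : V) : Measurable fun x : SignDual V => x.1 v :=
  (measurable_pi_apply v).comp measurable_subtype_coe

lemma measurable_eval (v : V) : Measurable (eval v) :=
  measurable_signVal.comp (measurable_coord v)

lemma integrable_eval (μ : Measure (SignDual V)) [IsFiniteMeasure μ] (v : V) :
    Integrable (eval v) μ :=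
  integrable_signVal (measurable_coord v)

/-- The map on sign characters induced by an endomorphism. -/
def comap (φ : V →+ V) (x : SignDual V) : SignDual V :=
  ⟨fun v => x.1 (φ v), fun v w => by simp only [map_add, x.2]⟩

@[simp] lemma eval_comap (φ : V →+ V) (v : V) (x : SignDual V) :
    eval v (comap φ x) = eval (φ v) x := rfl

lemma measurable_comap (φ : V →+ V) : Measurable (comap φ) :=
  Measurable.subtype_mk (measurable_pi_lambda _ fun v => measurable_coord (φ v))

/-- The trigonometric polynomials on the space of sign characters. -/
def trigPoly (V : Type) [AddCommGroup V] : Submodule ℝ (SignDual V → ℝ) :=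
  Submodule.span ℝ (Set.range eval)

lemma eval_mem (v : V) : eval v ∈ trigPoly V := Submodule.subset_span ⟨v, rfl⟩

lemma one_mem : (1 : SignDual V → ℝ) ∈ trigPoly V := by
  rw [← eval_zero]; exact eval_mem 0

lemma mul_mem {F G : SignDual V → ℝ} (hF : F ∈ trigPoly V) (hG : G ∈ trigPoly V) :
    F * G ∈ trigPoly V := by
  have h := Submodule.mul_mem_mul hF hG
  rw [trigPoly, Submodule.span_mul_span] at h
  refine Submodule.span_mono ?_ h
  rintro _ ⟨_, ⟨v, rfl⟩, _, ⟨w, rfl⟩, rfl⟩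
  exact ⟨v + w, eval_add v w⟩

lemma measurable_of_mem {F : SignDual V → ℝ} (hF : F ∈ trigPoly V) : Measurable F := by
  induction hF using Submodule.span_induction with
  | mem x h => obtain ⟨v, rfl⟩ := h; exact measurable_eval v
  | zero => exact measurable_zero
  | add x y _ _ hx hy => exact hx.add hy
  | smul a x _ hx => exact hx.const_smul a

lemma exists_sum_of_mem {F : SignDual V → ℝ} (hF : F ∈ trigPoly V) :
    ∃ (s : Finset V) (a : V → ℝ), ∀ x, F x = ∑ v ∈ s, a v * eval v x := by
  obtain ⟨a, rfl⟩ := Finsupp.mem_span_range_iff_exists_finsupp.1 hF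
  exact ⟨a.support, a, fun x => by simp [Finsupp.sum]⟩

/-- The sets whose indicator function is a trigonometric polynomial. -/
def trigSets (V : Type) [AddCommGroup V] : Set (Set (SignDual V)) :=
  {A | A.indicator (fun _ => (1 : ℝ)) ∈ trigPoly V}

lemma isSetAlgebra_trigSets : IsSetAlgebra (trigSets V) where
  empty_mem := by simp only [trigSets, Set.mem_ofPred_eq, Set.indicator_empty]; exact zero_mem _
  compl_mem A hA := by
    have : Aᶜ.indicator (fun _ => (1 : ℝ)) = 1 - A.indicator (fun _ => (1 : ℝ)) := by
      rw [Set.indicator_compl]; rfl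
    rw [trigSets, Set.mem_ofPred_eq, this]
    exact sub_mem one_mem hA
  union_mem A B hA hB := by
    have : (A ∪ B).indicator (fun _ => (1 : ℝ)) = A.indicator (fun _ => (1 : ℝ)) +
        B.indicator (fun _ => (1 : ℝ)) -
          A.indicator (fun _ => (1 : ℝ)) * B.indicator (fun _ => (1 : ℝ)) := by
      funext x
      by_cases h1 : x ∈ A <;> by_cases h2 : x ∈ B <;> simp [h1, h2]
    rw [trigSets, Set.mem_ofPred_eq, this]
    exact sub_mem (add_mem hA hB) (mul_mem hA hB)

lemma indicator_coord (v : V) (a : ℤˣ) :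
    {x : SignDual V | x.1 v = a}.indicator (fun _ => (1 : ℝ)) =
      (2⁻¹ : ℝ) • (1 + signVal a • eval v) := by
  funext x
  rcases Int.units_eq_one_or a with rfl | rfl <;>
    rcases Int.units_eq_one_or (x.1 v) with h | h <;>
    simp [h, eval, signVal, Set.indicator] <;> norm_num

lemma coord_mem_trigSets (v : V) (a : ℤˣ) : {x : SignDual V | x.1 v = a} ∈ trigSets V := by
  rw [trigSets, Set.mem_ofPred_eq, indicator_coord]
  exact Submodule.smul_mem _ _ (add_mem one_mem (Submodule.smul_mem _ _ (eval_mem v)))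

lemma measurableSet_of_mem {A : Set (SignDual V)} (hA : A ∈ trigSets V) : MeasurableSet A := by
  have : A = A.indicator (fun _ => (1 : ℝ)) ⁻¹' {1} := by
    ext x; by_cases h : x ∈ A <;> simp [h]
  rw [this]
  exact measurable_of_mem hA (measurableSet_singleton 1)

lemma generateFrom_trigSets :
    (inferInstance : MeasurableSpace (SignDual V)) = MeasurableSpace.generateFrom (trigSets V) := by
  refine le_antisymm ?_ (MeasurableSpace.generateFrom_le fun A hA => measurableSet_of_mem hA)
  refine Measurable.comap_le (m₁ := MeasurableSpace.generateFrom (trigSets V)) ?_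
  refine @measurable_pi_lambda _ _ _ (MeasurableSpace.generateFrom (trigSets V)) _ _ fun v => ?_
  refine @measurable_to_countable' _ _ _ _ (MeasurableSpace.generateFrom (trigSets V)) _ fun a => ?_
  exact MeasurableSpace.measurableSet_generateFrom (coord_mem_trigSets v a)

lemma integral_indicator_eq (μ : Measure (SignDual V)) {A : Set (SignDual V)}
    (hA : MeasurableSet A) : ∫ x, A.indicator (fun _ => (1 : ℝ)) x ∂μ = μ.real A := by
  simp [integral_indicator hA]

variable {c : V → ℝ} {μ : Measure (SignDual V)} [IsProbabilityMeasure μ]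

lemma integral_sum_eval (hμ : ∀ v, ∫ x, eval v x ∂μ = c v) {ι : Type*} (s : Finset ι)
    (a : ι → ℝ) (v : ι → V) :
    ∫ x, ∑ i ∈ s, a i * eval (v i) x ∂μ = ∑ i ∈ s, a i * c (v i) := by
  rw [integral_finsetSum _ fun i _ => (integrable_eval μ _).const_mul _]
  simp [integral_const_mul, hμ]

lemma measurePreserving_comap (hμ : ∀ v, ∫ x, eval v x ∂μ = c v) (φ : V →+ V)
    (hφ : ∀ v, c (φ v) = c v) : MeasurePreserving (comap φ) μ μ := by
  refine ⟨measurable_comap φ, ?_⟩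
  have : IsProbabilityMeasure (μ.map (comap φ)) :=
    Measure.isProbabilityMeasure_map (measurable_comap φ).aemeasurable
  refine ext_of_generate_finite (trigSets V) generateFrom_trigSets
    isSetAlgebra_trigSets.isSetRing.isSetSemiring.isPiSystem (fun A hA => ?_) (by simp)
  have hmA := measurableSet_of_mem hA
  rw [Measure.map_apply (measurable_comap φ) hmA]
  rw [← measureReal_eq_measureReal_iff, ← integral_indicator_eq μ hmA,
    ← integral_indicator_eq μ (measurable_comap φ hmA)]
  obtain ⟨s, a, h⟩ := exists_sum_of_mem hA
  have h' : ∀ x, ((comap φ) ⁻¹' A).indicator (fun _ => (1 : ℝ)) x =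
      ∑ v ∈ s, a v * eval (φ v) x := fun x => by
    simpa using! h (comap φ x)
  simp only [h, h', integral_sum_eval hμ, hφ]

/-- Correlations of trigonometric polynomials converge as soon as those of characters do. -/
lemma tendsto_integral_prod (hμ : ∀ v, ∫ x, eval v x ∂μ = c v) {r : ℕ}
    (φ : ℕ → Fin r → V →+ V)
    (h : ∀ p : Fin r → V, Tendsto (fun k => c (∑ i, φ k i (p i))) atTop (𝓝 (∏ i, c (p i))))
    (F : Fin r → SignDual V → ℝ) (hF : ∀ i, F i ∈ trigPoly V) :
    Tendsto (fun k => ∫ x, ∏ i, F i (comap (φ k i) x) ∂μ) atTop (𝓝 (∏ i, ∫ x, F i x ∂μ)) := by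
  choose s a hsa using fun i => exists_sum_of_mem (hF i)
  have h1 : ∀ k x, ∏ i, F i (comap (φ k i) x) =
      ∑ p ∈ Fintype.piFinset s, (∏ i, a i (p i)) * eval (∑ i, φ k i (p i)) x := by
    intro k x
    simp only [hsa, Finset.prod_univ_sum, eval_sum, eval_comap, Finset.prod_mul_distrib]
  have h2 : ∀ i, ∫ x, F i x ∂μ = ∑ v ∈ s i, a i v * c v := fun i => by
    simp only [hsa, integral_sum_eval hμ]
  simp only [h1, integral_sum_eval hμ]
  simp only [h2, Finset.prod_univ_sum, Finset.prod_mul_distrib]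
  exact tendsto_finsetSum _ fun p _ => (h p).const_mul _

lemma tendsto_characters_of_tendsto_sets (hμ : ∀ v, ∫ x, eval v x ∂μ = c v) {r : ℕ}
    (φ : ℕ → Fin r → V →+ V)
    (h : ∀ S : Fin r → Set (SignDual V), (∀ i, MeasurableSet (S i)) →
      Tendsto (fun k => μ (⋂ i, comap (φ k i) ⁻¹' S i)) atTop (𝓝 (∏ i, μ (S i))))
    (p : Fin r → V) : Tendsto (fun k => c (∑ i, φ k i (p i))) atTop (𝓝 (∏ i, c (p i))) := by
  have key : ∀ (v : V) (x : SignDual V), eval v x =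
      ∑ a : ℤˣ, signVal a * {x : SignDual V | x.1 v = a}.indicator (fun _ => (1 : ℝ)) x := by
    intro v x
    rw [Finset.sum_eq_single (x.1 v)]
    · simp [eval]
    · intro b _ hb
      simp [Ne.symm hb]
    · exact fun h => absurd (Finset.mem_univ _) h
  have hms : ∀ (v : V) (a : ℤˣ), MeasurableSet {x : SignDual V | x.1 v = a} :=
    fun v a => measurableSet_of_mem (coord_mem_trigSets v a)
  have hc : ∀ v, c v = ∑ a : ℤˣ, signVal a * μ.real {x : SignDual V | x.1 v = a} := by
    intro v
    rw [← hμ v]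
    simp_rw [key v]
    rw [integral_finsetSum _ fun a _ =>
      ((integrable_const _).indicator (hms v a)).const_mul _]
    simp only [integral_const_mul, integral_indicator_eq μ (hms v _)]
  have hc' : ∀ k, c (∑ i, φ k i (p i)) = ∑ e : Fin r → ℤˣ, (∏ i, signVal (e i)) *
      μ.real (⋂ i, comap (φ k i) ⁻¹' {x | x.1 (p i) = e i}) := by
    intro k
    have hm : ∀ e : Fin r → ℤˣ,
        MeasurableSet (⋂ i, comap (φ k i) ⁻¹' {x | x.1 (p i) = e i}) := fun e =>
      .iInter fun i => measurable_comap _ (hms _ _)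
    have hprod : ∀ x, eval (∑ i, φ k i (p i)) x = ∑ e : Fin r → ℤˣ, (∏ i, signVal (e i)) *
        (⋂ i, comap (φ k i) ⁻¹' {x | x.1 (p i) = e i}).indicator (fun _ => (1 : ℝ)) x := by
      intro x
      simp_rw [eval_sum, ← eval_comap, key, Finset.prod_univ_sum, Fintype.piFinset_univ,
        Finset.prod_mul_distrib]
      refine Finset.sum_congr rfl fun e _ => ?_
      rw [prod_indicator_preimage (fun i => comap (φ k i))]
    rw [← hμ]
    simp_rw [hprod]
    rw [integral_finsetSum _ fun e _ => ((integrable_const _).indicator (hm e)).const_mul _]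
    simp only [integral_const_mul, integral_indicator_eq μ (hm _)]
  simp only [hc', hc, Finset.prod_univ_sum, Fintype.piFinset_univ, Finset.prod_mul_distrib]
  refine tendsto_finsetSum _ fun e _ => Tendsto.const_mul _ ?_
  have := (ENNReal.tendsto_toReal (by
    exact ENNReal.prod_ne_top fun i _ => measure_ne_top _ _)).comp
      (h (fun i => {x | x.1 (p i) = e i}) fun i => hms _ _)
  simpa [ENNReal.toReal_prod, Measure.real, Function.comp_def] using this

end SignDual

lemma abs_prod_sub_prod_le {ι : Type*} (s : Finset ι) (a b : ι → ℝ) (ha : ∀ i, |a i| ≤ 1)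
    (hb : ∀ i, |b i| ≤ 1) : |∏ i ∈ s, a i - ∏ i ∈ s, b i| ≤ ∑ i ∈ s, |a i - b i| := by
  classical
  induction s using Finset.induction_on with
  | empty => simp
  | insert j s hj ih =>
    rw [Finset.prod_insert hj, Finset.prod_insert hj, Finset.sum_insert hj]
    have h1 : |∏ i ∈ s, a i| ≤ 1 := by
      rw [Finset.abs_prod]; exact Finset.prod_le_one (fun _ _ => abs_nonneg _) fun i _ => ha i
    calc |a j * ∏ i ∈ s, a i - b j * ∏ i ∈ s, b i|
        = |(a j - b j) * ∏ i ∈ s, a i + b j * (∏ i ∈ s, a i - ∏ i ∈ s, b i)| := by ring_nf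
      _ ≤ |a j - b j| * |∏ i ∈ s, a i| + |b j| * |∏ i ∈ s, a i - ∏ i ∈ s, b i| := by
        rw [← abs_mul, ← abs_mul]; exact abs_add_le _ _
      _ ≤ |a j - b j| * 1 + 1 * ∑ i ∈ s, |a i - b i| := by
        gcongr; exact hb j
      _ = _ := by ring

lemma measureReal_sub_le_symmDiff {X : Type*} [MeasurableSpace X] (μ : Measure X)
    [IsFiniteMeasure μ] {A B : Set X} (hA : MeasurableSet A) (hB : MeasurableSet B) :
    |μ.real A - μ.real B| ≤ μ.real (symmDiff A B) :=
  abs_measureReal_sub_le_measureReal_symmDiff hA.nullMeasurableSet hB.nullMeasurableSet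

open scoped symmDiff in
/-- Convergence of correlations passes from a generating algebra to all measurable sets. -/
lemma tendsto_measure_iInter_of_algebra {X : Type*} [mX : MeasurableSpace X] {μ : Measure X}
    [IsProbabilityMeasure μ] {C : Set (Set X)} (hC : IsSetAlgebra C)
    (hgen : mX = MeasurableSpace.generateFrom C) {r : ℕ} (T : ℕ → Fin r → X → X)
    (hT : ∀ k i, MeasurePreserving (T k i) μ μ)
    (h : ∀ S : Fin r → Set X, (∀ i, S i ∈ C) →
      Tendsto (fun k => μ.real (⋂ i, T k i ⁻¹' S i)) atTop (𝓝 (∏ i, μ.real (S i))))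
    (A : Fin r → Set X) (hA : ∀ i, MeasurableSet (A i)) :
    Tendsto (fun k => μ (⋂ i, T k i ⁻¹' A i)) atTop (𝓝 (∏ i, μ (A i))) := by
  have hCm : ∀ S ∈ C, MeasurableSet S := fun S hS =>
    hgen ▸ MeasurableSpace.measurableSet_generateFrom hS
  suffices H : Tendsto (fun k => μ.real (⋂ i, T k i ⁻¹' A i)) atTop (𝓝 (∏ i, μ.real (A i))) by
    rw [← ENNReal.tendsto_toReal_iff (fun k => measure_ne_top _ _)
      (ENNReal.prod_ne_top fun i _ => measure_ne_top _ _)]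
    simpa [ENNReal.toReal_prod, Measure.real] using H
  rw [Metric.tendsto_atTop]
  intro ε hε
  set δ := ε / (3 * (r + 1)) with hδ
  have hδ0 : 0 < δ := by positivity
  have hrδ : r * δ ≤ ε / 3 := by
    rw [hδ, ← mul_div_assoc, div_le_div_iff₀ (by positivity) (by positivity)]
    nlinarith
  have happ : ∀ i, ∃ t ∈ C, μ.real (A i ∆ t) ≤ δ := by
    intro i
    obtain ⟨t, ht, hlt⟩ := (Measure.MeasureDense.of_generateFrom_isSetAlgebra_finite μ hC
      hgen).approx (A i) (hA i) (measure_ne_top _ _) δ hδ0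
    exact ⟨t, ht, ENNReal.toReal_le_of_le_ofReal hδ0.le hlt.le⟩
  choose t htC ht using happ
  obtain ⟨N, hN⟩ := Metric.tendsto_atTop.1 (h t htC) (ε / 3) (by positivity)
  refine ⟨N, fun k hk => ?_⟩
  have h1 : |μ.real (⋂ i, T k i ⁻¹' A i) - μ.real (⋂ i, T k i ⁻¹' t i)| ≤ r * δ := by
    have hsub : (⋂ i, T k i ⁻¹' A i) ∆ (⋂ i, T k i ⁻¹' t i) ⊆
        ⋃ i ∈ (Finset.univ : Finset (Fin r)), T k i ⁻¹' (A i ∆ t i) := by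
      intro x hx
      simp only [Set.mem_symmDiff, Set.mem_iInter, Set.mem_preimage, Finset.mem_univ,
        Set.iUnion_true, Set.mem_iUnion, not_forall] at hx ⊢
      rcases hx with ⟨h1, i, hi⟩ | ⟨h1, i, hi⟩
      · exact ⟨i, .inl ⟨h1 i, hi⟩⟩
      · exact ⟨i, .inr ⟨h1 i, hi⟩⟩
    calc _ ≤ μ.real ((⋂ i, T k i ⁻¹' A i) ∆ (⋂ i, T k i ⁻¹' t i)) :=
          measureReal_sub_le_symmDiff μ
            (.iInter fun i => (hT k i).measurable (hA i))
            (.iInter fun i => (hT k i).measurable (hCm _ (htC i)))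
      _ ≤ μ.real (⋃ i ∈ (Finset.univ : Finset (Fin r)), T k i ⁻¹' (A i ∆ t i)) :=
          measureReal_mono hsub (measure_ne_top _ _)
      _ ≤ ∑ i : Fin r, μ.real (T k i ⁻¹' (A i ∆ t i)) := measureReal_biUnion_finset_le _ _
      _ ≤ ∑ i : Fin r, δ := by
          refine Finset.sum_le_sum fun i _ => ?_
          rw [(hT k i).measureReal_preimage
            ((hA i).symmDiff (hCm _ (htC i))).nullMeasurableSet]
          exact ht i
      _ = r * δ := by simp
  have h2 : |∏ i, μ.real (t i) - ∏ i, μ.real (A i)| ≤ r * δ := by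
    have hle : ∀ B : Set X, |μ.real B| ≤ 1 := fun B => by
      rw [abs_of_nonneg measureReal_nonneg]; exact measureReal_le_one
    calc _ ≤ ∑ i, |μ.real (t i) - μ.real (A i)| :=
          abs_prod_sub_prod_le _ _ _ (fun i => hle _) fun i => hle _
      _ ≤ ∑ i : Fin r, δ := by
          refine Finset.sum_le_sum fun i _ => ?_
          rw [abs_sub_comm]
          exact (measureReal_sub_le_symmDiff μ (hA i) (hCm _ (htC i))).trans (ht i)
      _ = r * δ := by simp
  have h3 := hN k hk
  rw [Real.dist_eq] at h3 ⊢
  rw [abs_lt] at h3 ⊢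
  rw [abs_le] at h1 h2
  constructor <;> linarith

/-- An invariant mean of random sign characters gives a measure-preserving system whose
multiple correlations are governed by that mean. -/
theorem exists_system_of_isSignMean {V : Type} [AddCommGroup V] {d : ℕ}
    (ρ : (Fin d → ℤ) → V →+ V) (hρ0 : ρ 0 = AddMonoidHom.id V)
    (hρ : ∀ m n, ρ (m + n) = (ρ m).comp (ρ n)) {c : V → ℝ} (hc : IsSignMean c)
    (hinv : ∀ n v, c (ρ n v) = c v) :
    ∃ A : MPSystem d, ∀ (r : ℕ) (n : ℕ → Fin r → (Fin d → ℤ)),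
      (∀ S : Fin r → Set A.X, (∀ i, MeasurableSet (S i)) →
        Tendsto (fun k => A.μ (⋂ i, A.act (n k i) ⁻¹' S i)) atTop (𝓝 (∏ i, A.μ (S i)))) ↔
      ∀ p : Fin r → V,
        Tendsto (fun k => c (∑ i, ρ (n k i) (p i))) atTop (𝓝 (∏ i, c (p i))) := by
  obtain ⟨Ω, _, P, _, ξ, hξm, hξ, hξc⟩ := hc
  let f : Ω → SignDual V := fun ω => ⟨fun v => ξ v ω, fun v w => hξ v w ω⟩
  have hf : Measurable f := Measurable.subtype_mk (measurable_pi_lambda _ hξm)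
  have hprob : IsProbabilityMeasure (P.map f) :=
    Measure.isProbabilityMeasure_map hf.aemeasurable
  have hμ : ∀ v, ∫ x, SignDual.eval v x ∂(P.map f) = c v := fun v => by
    rw [integral_map hf.aemeasurable (SignDual.measurable_eval v).aestronglyMeasurable]
    exact hξc v
  have hmp := fun n => SignDual.measurePreserving_comap hμ (ρ n) (hinv n)
  refine ⟨{ X := SignDual V, μ := P.map f, act := fun n => SignDual.comap (ρ n),
            act_zero := ?_, act_add := ?_, mp := hmp }, fun r n => ⟨fun h p => ?_, fun h => ?_⟩⟩
  · rw [hρ0]; rfl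
  · intro m n
    rw [add_comm, hρ]; rfl
  · exact SignDual.tendsto_characters_of_tendsto_sets hμ (fun k i => ρ (n k i)) h p
  · refine tendsto_measure_iInter_of_algebra SignDual.isSetAlgebra_trigSets
      SignDual.generateFrom_trigSets _ (fun k i => hmp _) fun S hS => ?_
    have := SignDual.tendsto_integral_prod hμ (fun k i => ρ (n k i)) h
      (fun i => (S i).indicator fun _ => 1) hS
    simp only [SignDual.integral_indicator_eq _ (SignDual.measurableSet_of_mem (hS _))] at this
    refine this.congr fun k => ?_
    rw [← SignDual.integral_indicator_eq _
      (.iInter fun i => (hmp _).measurable (SignDual.measurableSet_of_mem (hS i)))]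
    exact integral_congr_ae (.of_forall fun x => prod_indicator_preimage _ S x)

/-! ### Constructing means of random sign characters -/

lemma integral_infinitePi_prod {ι : Type*} {Ω : ι → Type*} [∀ b, MeasurableSpace (Ω b)]
    (P : ∀ b, Measure (Ω b)) [∀ b, IsProbabilityMeasure (P b)] (T : Finset ι)
    {f : ∀ b, Ω b → ℝ} (hf : ∀ b, Measurable (f b)) :
    ∫ ω, ∏ b ∈ T, f b (ω b) ∂(Measure.infinitePi P) = ∏ b ∈ T, ∫ x, f b x ∂(P b) := by
  have hind := (ProbabilityTheory.iIndepFun_infinitePi (P := P) (X := f) hf).precomp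
    (g := fun b : T => (b : ι)) Subtype.val_injective
  have hint := hind.integral_fun_prod_eq_prod_integral
    fun b => ((hf b).comp (measurable_pi_apply _)).aestronglyMeasurable
  have hleft : ∀ ω : ∀ b, Ω b, ∏ b : T, f b (ω b) = ∏ b ∈ T, f b (ω b) := fun ω =>
    Finset.prod_coe_sort T fun b => f b (ω b)
  simp_rw [hleft] at hint
  rw [hint, ← Finset.prod_coe_sort T]
  refine Finset.prod_congr rfl fun b _ => ?_
  rw [← (measurePreserving_eval_infinitePi P (b : ι)).map_eq,
    integral_map (measurable_pi_apply _).aemeasurable (hf b).aestronglyMeasurable]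

/-- An independent family of random sign characters, locally finite in the sense that every
element is trivial under all but finitely many of them, can be multiplied. -/
lemma isSignMean_finprod {V ι : Type} [AddCommGroup V] {Ω : ι → Type}
    [∀ b, MeasurableSpace (Ω b)] (P : ∀ b, Measure (Ω b)) [∀ b, IsProbabilityMeasure (P b)]
    (ξ : ∀ b, V → Ω b → ℤˣ) (hm : ∀ b v, Measurable (ξ b v))
    (hadd : ∀ b v w ω, ξ b (v + w) ω = ξ b v ω * ξ b w ω)
    (hfin : ∀ v, {b | ξ b v ≠ 1}.Finite) :
    IsSignMean fun v => ∏ᶠ b, ∫ ω, signVal (ξ b v ω) ∂(P b) := by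
  have hsupp : ∀ v (ω : ∀ b, Ω b), Function.HasFiniteMulSupport fun b => ξ b v (ω b) :=
    fun v ω => (hfin v).subset fun b hb h => hb (by simp [h])
  have heq : ∀ v (ω : ∀ b, Ω b), ∏ᶠ b, ξ b v (ω b) = ∏ b ∈ (hfin v).toFinset, ξ b v (ω b) :=
    fun v ω => finprod_eq_prod_of_mulSupport_subset _ fun b hb => by
      rw [Set.Finite.coe_toFinset]
      exact fun h => hb (by simp [h])
  refine ⟨∀ b, Ω b, inferInstance, Measure.infinitePi P, inferInstance,
    fun v ω => ∏ᶠ b, ξ b v (ω b), fun v => ?_, fun v w ω => ?_, fun v => ?_⟩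
  · simp_rw [heq]
    exact Finset.measurable_prod _ fun b _ => (hm b v).comp (measurable_pi_apply b)
  · simp_rw [hadd]
    exact finprod_mul_distrib (hsupp v ω) (hsupp w ω)
  · simp_rw [heq, signVal_prod]
    rw [integral_infinitePi_prod P _ (f := fun b ω => signVal (ξ b v ω)) fun b =>
      measurable_signVal.comp (hm b v)]
    refine (finprod_eq_prod_of_mulSupport_subset _ fun b hb => ?_).symm
    rw [Set.Finite.coe_toFinset]
    exact fun h => hb (by simp [h])

lemma IsSignMean.prod {V W : Type} [AddCommGroup V] [AddCommGroup W] {c : V → ℝ} {d : W → ℝ}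
    (hc : IsSignMean c) (hd : IsSignMean d) : IsSignMean fun v : V × W => c v.1 * d v.2 := by
  obtain ⟨Ω, _, P, _, ξ, hξm, hξ, hξc⟩ := hc
  obtain ⟨Ω', _, Q, _, η, hηm, hη, hηd⟩ := hd
  refine ⟨Ω × Ω', inferInstance, P.prod Q, inferInstance, fun v ω => ξ v.1 ω.1 * η v.2 ω.2,
    fun v => ((hξm _).comp measurable_fst).mul ((hηm _).comp measurable_snd), fun v w ω => ?_,
    fun v => ?_⟩
  · simp only [Prod.fst_add, Prod.snd_add, hξ, hη]
    exact mul_mul_mul_comm _ _ _ _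
  · simp_rw [signVal_mul]
    rw [integral_prod_mul (fun ω => signVal (ξ v.1 ω)) fun ω => signVal (η v.2 ω), hξc, hηd]

lemma isSignMean_one (V : Type) [AddCommGroup V] : IsSignMean fun _ : V => (1 : ℝ) :=
  ⟨Unit, inferInstance, Measure.dirac (), inferInstance, fun _ _ => 1, fun _ => measurable_const,
    fun _ _ _ => (one_mul 1).symm, fun _ => by simp⟩

/-- The sign `(-1)^a` of a residue class modulo two. -/
def zmodSign (a : ZMod 2) : ℤˣ := if a = 0 then 1 else -1

lemma zmodSign_add : ∀ a b : ZMod 2, zmodSign (a + b) = zmodSign a * zmodSign b := by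
  decide

open Classical in
/-- The expectation of the Haar measure on the characters of a vector space over `𝔽₂`. -/
lemma isSignMean_haar (V : Type) [AddCommGroup V] [Module (ZMod 2) V] :
    IsSignMean fun v : V => if v = 0 then (1 : ℝ) else 0 := by
  let B := Module.Basis.ofVectorSpace (ZMod 2) V
  have hP : ∀ a : ZMod 2, ∫ ω, signVal (zmodSign (ω * a))
      ∂(PMF.uniformOfFintype (ZMod 2)).toMeasure = if a = 0 then 1 else 0 := by
    intro a
    have hsum : ∀ F : ZMod 2 → ℝ, ∑ ω, F ω = F 0 + F 1 := Fin.sum_univ_two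
    have ha : a = 0 ∨ a = 1 := by revert a; decide
    rw [PMF.integral_eq_sum, hsum]
    rcases ha with rfl | rfl <;> norm_num [zmodSign, signVal]
  have h := isSignMean_finprod (fun _ => (PMF.uniformOfFintype (ZMod 2)).toMeasure)
    (fun b v ω => zmodSign (ω * B.repr v b)) (fun _ _ => .of_discrete)
    (fun b v w ω => by rw [map_add, Finsupp.add_apply, mul_add, zmodSign_add])
    (fun v => (B.repr v).hasFiniteSupport.subset fun b hb h => hb (by
      funext ω; simp [h, zmodSign]))
  convert h using 2 with v
  simp_rw [hP]
  by_cases hv : v = 0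
  · simp [hv]
  · rw [if_neg hv]
    obtain ⟨b, hb⟩ : ∃ b, B.repr v b ≠ 0 := by
      by_contra! hb
      exact hv (B.repr.map_eq_zero_iff.1 (Finsupp.ext hb))
    exact (finprod_eq_zero _ b (if_neg hb) ((B.repr v).hasFiniteSupport.subset fun b hb h =>
      hb (by simp [h]))).symm

/-- The number of points of a Poisson process with odd multiplicity. -/
lemma integral_poisson_sign {S : Type} [MeasurableSpace S] (Q : Measure S)
    [IsProbabilityMeasure Q] {g : S → ℤˣ} (hg : Measurable g) :
    ∫ ω, signVal (∏ i ∈ Finset.range ω.1, g (ω.2 i))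
      ∂((ProbabilityTheory.poissonMeasure 1).prod (Measure.infinitePi fun _ : ℕ => Q)) =
      Real.exp (∫ s, signVal (g s) ∂Q - 1) := by
  have hm : Measurable fun ω : ℕ × (ℕ → S) => ∏ i ∈ Finset.range ω.1, g (ω.2 i) :=
    measurable_from_prod_countable_right fun n =>
      Finset.measurable_prod (Finset.range n) fun i _ =>
        show Measurable fun p : ℕ → S => g (p i) from hg.comp (measurable_pi_apply i)
  rw [integral_prod _ (integrable_signVal hm)]
  simp_rw [signVal_prod]
  have h := fun n => integral_infinitePi_prod (fun _ : ℕ => Q) (Finset.range n)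
    (f := fun _ s => signVal (g s)) fun _ => measurable_signVal.comp hg
  simp_rw [h, Finset.prod_const, Finset.card_range, ProbabilityTheory.integral_poissonMeasure]
  rw [sub_eq_neg_add, Real.exp_add, Real.exp_eq_exp_ℝ,
    congrFun (NormedSpace.exp_eq_tsum_div (𝔸 := ℝ)) (∫ s, signVal (g s) ∂Q), ← tsum_mul_left]
  refine tsum_congr fun n => ?_
  simp
  ring

/-- The group of measurable integer-valued functions on the line with bounded support. -/
def BoundedSupport : AddSubgroup (ℝ → ℤ) where
  carrier := {f | Measurable f ∧ ∃ M : ℝ, ∀ x, M < |x| → f x = 0}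
  zero_mem' := ⟨measurable_const, 0, fun _ _ => rfl⟩
  add_mem' := by
    rintro f g ⟨hf, M, hM⟩ ⟨hg, N, hN⟩
    refine ⟨hf.add hg, max M N, fun x hx => ?_⟩
    simp [hM x ((le_max_left _ _).trans_lt hx), hN x ((le_max_right _ _).trans_lt hx)]
  neg_mem' := by
    rintro f ⟨hf, M, hM⟩
    exact ⟨hf.neg, M, fun x hx => by simp [hM x hx]⟩

namespace BoundedSupport

/-- Twice the indicator function of the set where `f` is odd. -/
def oddPart (f : ℝ → ℤ) (x : ℝ) : ℝ := 1 - signVal (f x).negOnePow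

lemma oddPart_of_eq_zero {f : ℝ → ℤ} {x : ℝ} (h : f x = 0) : oddPart f x = 0 := by
  simp [oddPart, h]

lemma oddPart_nonneg (f : ℝ → ℤ) (x : ℝ) : 0 ≤ oddPart f x := by
  rcases signVal_eq_or (f x).negOnePow with h | h <;> norm_num [oddPart, h]

lemma oddPart_le (f : ℝ → ℤ) (x : ℝ) : oddPart f x ≤ 2 := by
  rcases signVal_eq_or (f x).negOnePow with h | h <;> norm_num [oddPart, h]

lemma measurable_oddPart {f : ℝ → ℤ} (hf : Measurable f) : Measurable (oddPart f) :=
  measurable_const.sub ((Measurable.of_discrete (f := fun n : ℤ => signVal n.negOnePow)).comp hf)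

lemma integrable_oddPart (f : BoundedSupport) : Integrable (oddPart f) := by
  obtain ⟨M, hM⟩ := f.2.2
  have hon : IntegrableOn (oddPart f) (Set.Icc (-M) M) :=
    .of_bound (measure_Icc_lt_top) (measurable_oddPart f.2.1).aestronglyMeasurable 2
      (.of_forall fun x => by
        rw [Real.norm_eq_abs, abs_of_nonneg (oddPart_nonneg _ _)]; exact oddPart_le _ _)
  refine hon.integrable_of_forall_notMem_eq_zero fun x hx => oddPart_of_eq_zero (hM x ?_)
  by_contra! h
  exact hx (abs_le.1 h)

/-- The expected sign of the sum of the values of `f` over a Poisson process on the line. -/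
def poissonMean (f : BoundedSupport) : ℝ := Real.exp (-∫ x, oddPart f x)

lemma isSignMean_poissonMean : IsSignMean poissonMean := by
  let Q : Measure ℝ := volume.restrict (Set.Ico 0 1)
  have hQ : IsProbabilityMeasure Q := ⟨by simp [Q]⟩
  let g : ℤ → BoundedSupport → ℝ → ℤˣ := fun m f t => (f.1 (Int.fract t + m)).negOnePow
  have hg : ∀ m f, Measurable (g m f) := fun m f =>
    (Measurable.of_discrete (f := Int.negOnePow)).comp
      (f.2.1.comp (measurable_fract.add_const _))
  have hgadd : ∀ m f f' t, g m (f + f') t = g m f t * g m f' t := fun m f f' t =>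
    Int.negOnePow_add _ _
  have hfin : ∀ f, {m | g m f ≠ 1}.Finite := by
    intro f
    obtain ⟨M, hM⟩ := f.2.2
    refine (Set.finite_Icc (-⌈M⌉ - 1) ⌈M⌉).subset fun m hm => ?_
    by_contra hout
    refine hm (funext fun t => ?_)
    have : f.1 (Int.fract t + m) = 0 := by
      have h0 := Int.fract_nonneg t
      have h1 := Int.fract_lt_one t
      have hc := Int.le_ceil M
      refine hM _ (lt_abs.2 ?_)
      rw [Set.mem_Icc, not_and_or, not_le, not_le] at hout
      rcases hout with h | h
      · right
        have : (m : ℝ) + 1 ≤ -⌈M⌉ - 1 := by exact_mod_cast h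
        linarith
      · left
        have : (⌈M⌉ : ℝ) + 1 ≤ m := by exact_mod_cast h
        linarith
    simp [g, this]
  have hint : ∀ m f, ∫ t, signVal (g m f t) ∂Q - 1 =
      -∫ t in (0 : ℝ)..1, oddPart f (t + m) := by
    intro m f
    have h1 : ∫ t, signVal (g m f t) ∂Q = ∫ t, (1 - oddPart f (t + m)) ∂Q := by
      refine setIntegral_congr_fun measurableSet_Ico fun t ht => ?_
      simp [oddPart, g, Int.fract_eq_self.2 ht]
    have h2 : Integrable (fun t => oddPart f (t + m)) Q :=
      ((integrable_oddPart f).comp_add_right (m : ℝ)).mono_measure Measure.restrict_le_self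
    rw [h1, integral_sub (integrable_const _) h2, intervalIntegral.integral_of_le zero_le_one,
      ← integral_Ico_eq_integral_Ioc]
    simp [Q]
  have h := isSignMean_finprod (V := BoundedSupport) (Ω := fun _ : ℤ => ℕ × (ℕ → ℝ))
    (fun _ => (ProbabilityTheory.poissonMeasure 1).prod (Measure.infinitePi fun _ : ℕ => Q))
    (fun m f ω => ∏ i ∈ Finset.range ω.1, g m f (ω.2 i))
    (fun m f => measurable_from_prod_countable_right fun n =>
      Finset.measurable_prod (Finset.range n) fun i _ =>
        show Measurable fun p : ℕ → ℝ => g m f (p i) from (hg m f).comp (measurable_pi_apply i))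
    (fun m f f' ω => by simp only [hgadd, Finset.prod_mul_distrib])
    (fun f => (hfin f).subset fun m hm h => hm (by
      funext ω; simp [h]))
  convert h using 2 with f
  simp_rw [integral_poisson_sign Q (hg _ f), hint]
  have hzero : ∀ m, g m f = 1 → ∫ t in (0 : ℝ)..1, oddPart f (t + m) = 0 := by
    intro m hm
    have := hint m f
    rw [hm] at this
    simpa using this
  rw [finprod_eq_prod_of_mulSupport_subset (s := (hfin f).toFinset) _ fun m hm => by
      rw [Set.Finite.coe_toFinset]
      exact fun h => hm (by simp [hzero m h]), ← Real.exp_sum, Finset.sum_neg_distrib, poissonMean]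
  congr 2
  refine (integrable_oddPart f).hasSum_intervalIntegral_comp_add_int.unique
    (hasSum_sum_of_ne_finset_zero fun m hm => hzero m ?_)
  by_contra hne
  exact hm ((hfin f).mem_toFinset.2 hne)

/-- The action of translations. -/
def translate (t : ℝ) : BoundedSupport →+ BoundedSupport where
  toFun f := ⟨fun x => f.1 (x - t), f.2.1.comp (measurable_id.sub_const t), by
    obtain ⟨M, hM⟩ := f.2.2
    refine ⟨M + |t|, fun x hx => hM _ ?_⟩
    have := abs_sub_abs_le_abs_sub x t
    linarith⟩
  map_zero' := rfl
  map_add' _ _ := rfl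

@[simp] lemma translate_apply (t : ℝ) (f : BoundedSupport) (x : ℝ) :
    (translate t f).1 x = f.1 (x - t) := rfl

lemma translate_zero : translate 0 = AddMonoidHom.id _ := by
  ext f x; simp

lemma translate_add (s t : ℝ) : translate (s + t) = (translate s).comp (translate t) := by
  ext f x; simp [sub_sub]

lemma poissonMean_zero : poissonMean 0 = 1 := by
  simp [poissonMean, oddPart]

lemma poissonMean_translate (t : ℝ) (f : BoundedSupport) :
    poissonMean (translate t f) = poissonMean f := by
  have := integral_sub_right_eq_self (μ := volume) (oddPart f) t
  simp only [poissonMean]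
  rw [← this]
  rfl

lemma poissonMean_sum {ι : Type*} (s : Finset ι) (f : ι → BoundedSupport)
    (h : ∀ x, ∀ i ∈ s, ∀ j ∈ s, i ≠ j → (f i).1 x = 0 ∨ (f j).1 x = 0) :
    poissonMean (∑ i ∈ s, f i) = ∏ i ∈ s, poissonMean (f i) := by
  have hx : ∀ x, oddPart (∑ i ∈ s, f i : BoundedSupport) x = ∑ i ∈ s, oddPart (f i) x := by
    intro x
    have hval : (∑ i ∈ s, f i : BoundedSupport).1 x = ∑ i ∈ s, (f i).1 x := by
      simp
    by_cases hz : ∃ i ∈ s, (f i).1 x ≠ 0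
    · obtain ⟨i, hi, hne⟩ := hz
      have h0 : ∀ j ∈ s, j ≠ i → (f j).1 x = 0 := fun j hj hji =>
        (h x i hi j hj hji.symm).resolve_left hne
      rw [Finset.sum_eq_single_of_mem i hi fun j hj hji => oddPart_of_eq_zero (h0 j hj hji),
        oddPart, hval, Finset.sum_eq_single_of_mem i hi h0, oddPart]
    · push Not at hz
      rw [oddPart_of_eq_zero (hval.trans (Finset.sum_eq_zero hz)),
        Finset.sum_eq_zero fun i hi => oddPart_of_eq_zero (hz i hi)]
  simp only [poissonMean, hx]
  rw [integral_finsetSum _ fun i _ => integrable_oddPart (f i), ← Finset.sum_neg_distrib,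
    Real.exp_sum]

/-- Translates that drift apart become independent. -/
lemma eventually_poissonMean_translate {r : ℕ} {t : Fin r → ℝ} (ht : Function.Injective t)
    (f : Fin r → BoundedSupport) :
    ∀ᶠ k : ℕ in atTop, poissonMean (∑ i, translate (k * t i) (f i)) = ∏ i, poissonMean (f i) := by
  choose M hM using fun i => (f i).2.2
  have hpair : ∀ i j, i ≠ j → ∀ᶠ k : ℕ in atTop, M i + M j < k * |t i - t j| := by
    intro i j hij
    have hpos : 0 < |t i - t j| := abs_pos.2 (sub_ne_zero.2 (ht.ne hij))
    exact (tendsto_natCast_atTop_atTop.atTop_mul_const hpos).eventually_gt_atTop _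
  have hall : ∀ᶠ k : ℕ in atTop, ∀ i j, i ≠ j → M i + M j < k * |t i - t j| := by
    simp only [eventually_all]
    exact hpair
  filter_upwards [hall] with k hk
  rw [poissonMean_sum]
  · simp only [poissonMean_translate]
  · intro x i _ j _ hij
    by_contra! hne
    have hi : |x - k * t i| ≤ M i := by
      by_contra! h; exact hne.1 (hM i _ h)
    have hj : |x - k * t j| ≤ M j := by
      by_contra! h; exact hne.2 (hM j _ h)
    have h1 : (k : ℝ) * |t i - t j| = |(x - k * t j) - (x - k * t i)| := by
      rw [show (x - k * t j) - (x - k * t i) = k * (t i - t j) by ring, abs_mul, Nat.abs_cast]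
    have := abs_sub (x - k * t j) (x - k * t i)
    linarith [hk i j hij]

/-- The indicator function of the unit interval. -/
def unitBlock : BoundedSupport :=
  ⟨(Set.Ico (0 : ℝ) 1).indicator 1, measurable_one.indicator measurableSet_Ico, 1, fun x hx =>
    Set.indicator_of_notMem (fun h => by
      rw [abs_of_nonneg h.1] at hx; exact hx.not_gt h.2) _⟩

lemma poissonMean_unitBlock : poissonMean unitBlock = Real.exp (-2) := by
  have : oddPart unitBlock = (Set.Ico (0 : ℝ) 1).indicator fun _ => 2 := by
    funext x
    by_cases h : x ∈ Set.Ico (0 : ℝ) 1 <;> norm_num [oddPart, unitBlock, h, signVal]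
  rw [poissonMean, this, integral_indicator_const _ measurableSet_Ico]
  simp

/-- A block and its translate by a small vector almost cancel. -/
lemma le_poissonMean_unitBlock (t : ℝ) :
    Real.exp (-(8 * |t|)) ≤ poissonMean (unitBlock + translate t unitBlock) := by
  have ht := abs_nonneg t
  set G : ℝ → ℝ := fun x => (Set.Icc (-|t|) |t|).indicator (fun _ => 2) x +
    (Set.Icc (1 - |t|) (1 + |t|)).indicator (fun _ => 2) x with hG
  have hi : ∀ a b : ℝ, Integrable ((Set.Icc a b).indicator fun _ => (2 : ℝ)) := fun a b =>
    (integrable_indicator_iff measurableSet_Icc).2 (integrableOn_const measure_Icc_lt_top.ne)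
  have hle : ∀ x, oddPart (unitBlock + translate t unitBlock : BoundedSupport) x ≤ G x := by
    intro x
    have h0 : ∀ s : Set ℝ, 0 ≤ s.indicator (fun _ => (2 : ℝ)) x := fun s =>
      Set.indicator_nonneg (fun _ _ => zero_le_two) x
    by_cases h1 : x ∈ Set.Icc (-|t|) |t|
    · refine (oddPart_le _ _).trans ?_
      simp only [hG, Set.indicator_of_mem h1]
      linarith [h0 (Set.Icc (1 - |t|) (1 + |t|))]
    by_cases h2 : x ∈ Set.Icc (1 - |t|) (1 + |t|)
    · refine (oddPart_le _ _).trans ?_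
      simp only [hG, Set.indicator_of_mem h2]
      linarith [h0 (Set.Icc (-|t|) |t|)]
    have h3 : x ∈ Set.Ico (0 : ℝ) 1 ↔ x - t ∈ Set.Ico (0 : ℝ) 1 := by
      have ht1 := le_abs_self t
      have ht2 := neg_abs_le t
      simp only [Set.mem_Icc, not_and_or, not_le] at h1 h2
      constructor <;> rintro ⟨ha, hb⟩ <;> constructor <;>
        rcases h1 with h1 | h1 <;> rcases h2 with h2 | h2 <;> linarith
    have hval : (unitBlock + translate t unitBlock : BoundedSupport).1 x =
        (Set.Ico (0 : ℝ) 1).indicator 1 x + (Set.Ico (0 : ℝ) 1).indicator 1 (x - t) := rfl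
    have : oddPart (unitBlock + translate t unitBlock : BoundedSupport) x = 0 := by
      rw [oddPart, hval]
      by_cases h : x ∈ Set.Ico (0 : ℝ) 1
      · rw [Set.indicator_of_mem h, Set.indicator_of_mem (h3.1 h)]
        simp [Int.negOnePow_even 2 even_two]
      · rw [Set.indicator_of_notMem h, Set.indicator_of_notMem (h3.not.1 h)]
        simp
    rw [this]
    exact add_nonneg (h0 _) (h0 _)
  have hint : ∫ x, G x = 8 * |t| := by
    rw [integral_add (hi _ _) (hi _ _), integral_indicator_const _ measurableSet_Icc,
      integral_indicator_const _ measurableSet_Icc]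
    simp only [Real.volume_real_Icc, smul_eq_mul]
    rw [max_eq_left (by linarith), max_eq_left (by linarith)]
    ring
  rw [poissonMean, Real.exp_le_exp, neg_le_neg_iff, ← hint]
  exact integral_mono (integrable_oddPart _) ((hi _ _).add (hi _ _)) hle

end BoundedSupport

/-! ### Systems that are only 1-mixing, with a prescribed algebraic factor -/

/-- The embedding of `ℤ²` in the line given by a slope of `√2`. -/
def drift : (Fin 2 → ℤ) →+ ℝ where
  toFun n := n 0 + n 1 * √2
  map_zero' := by simp
  map_add' m n := by
    simp only [Pi.add_apply, Int.cast_add]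
    ring

lemma drift_apply (n : Fin 2 → ℤ) : drift n = n 0 + n 1 * √2 := rfl

lemma drift_injective : Function.Injective drift := by
  rw [injective_iff_map_eq_zero]
  intro n hn
  rw [drift_apply] at hn
  have h1 : n 1 = 0 := by
    by_contra h1
    refine (irrational_sqrt_two.intCast_mul h1).ne_int (-n 0) ?_
    push_cast
    linarith
  have h0 : n 0 = 0 := by
    rw [h1] at hn
    simpa using hn
  funext i
  fin_cases i
  exacts [h0, h1]

/-- A sequence of vectors whose drifts tend to zero. -/
def slowVector : ℕ → Fin 2 → ℤ
  | 0 => ![1, 0]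
  | j + 1 => ![2 * slowVector j 1 - slowVector j 0, slowVector j 0 - slowVector j 1]

lemma drift_slowVector (j : ℕ) : drift (slowVector j) = (√2 - 1) ^ j := by
  induction j with
  | zero => simp [slowVector, drift_apply]
  | succ j ih =>
    rw [pow_succ, ← ih]
    simp only [slowVector, drift_apply, Matrix.cons_val_zero, Matrix.cons_val_one]
    push_cast
    have : √2 * √2 = 2 := Real.mul_self_sqrt zero_le_two
    linear_combination (-(slowVector j 1 : ℝ)) * this

lemma sqrt_two_sub_one_mem : 0 < √2 - 1 ∧ √2 - 1 < 1 := by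
  constructor
  · linarith [Real.one_lt_sqrt_two]
  · linarith [Real.sqrt_two_lt_three_halves]

lemma slowVector_injective : Function.Injective slowVector := by
  intro i j h
  have := congrArg drift h
  rw [drift_slowVector, drift_slowVector] at this
  exact pow_right_injective₀ sqrt_two_sub_one_mem.1 sqrt_two_sub_one_mem.2.ne this

lemma movesApart_slowVector (r : ℕ) :
    MovesApart fun j (i : Fin r) => (i : ℤ) • slowVector j := by
  intro s t hst
  have hne : ((s : ℤ) - t) ≠ 0 := sub_ne_zero.2 fun h => hst (Fin.ext (by exact_mod_cast h))
  have hinj : Function.Injective fun j => ((s : ℤ) - t) • slowVector j :=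
    (smul_right_injective _ hne).comp slowVector_injective
  have h := tendsto_norm_cocompact_atTop.comp
    ((cocompact_eq_cofinite (Fin 2 → ℤ)).symm ▸ hinj.tendsto_cofinite)
  rw [Nat.cofinite_eq_atTop] at h
  simpa [Function.comp_def, sub_smul] using h

lemma mixingOrder_eq_one {X : Type*} [MeasurableSpace X] {d : ℕ} {μ : Measure X}
    {α : (Fin d → ℤ) → X → X} (h1 : IsMixingOfOrder μ α 1)
    (h2 : ∀ r, IsMixingOfOrder μ α (r + 2) → False) : mixingOrder μ α = 1 := by
  refine le_antisymm (sSup_le ?_) (le_sSup ⟨1, h1, rfl⟩)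
  rintro _ ⟨r, hr, rfl⟩
  match r, hr with
  | 0, _ => exact_mod_cast zero_le_one
  | 1, _ => exact le_rfl
  | r + 2, hr => exact (h2 r hr).elim

open BoundedSupport in
/-- A random sign character with an action of `ℤ²` gives a system that is not 2-mixing, whose
mixing shapes are determined by the given action. -/
theorem exists_system_mixOrder_eq_one {V : Type} [AddCommGroup V]
    (σ : (Fin 2 → ℤ) → V →+ V) (hσ0 : σ 0 = AddMonoidHom.id V)
    (hσ : ∀ m n, σ (m + n) = (σ m).comp (σ n)) {δ : V → ℝ} (hδ : IsSignMean δ)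
    (hinv : ∀ n v, δ (σ n v) = δ v) (hδ0 : δ 0 = 1) :
    ∃ A : MPSystem 2, A.mixOrder = 1 ∧ ∀ (r : ℕ) (n : Fin r → (Fin 2 → ℤ)),
      Function.Injective n → (IsMixingShape A.μ A.act n ↔ ∀ p : Fin r → V,
        Tendsto (fun k : ℕ => δ (∑ i, σ ((k : ℤ) • n i) (p i))) atTop (𝓝 (∏ i, δ (p i)))) := by
  obtain ⟨A, hA⟩ := exists_system_of_isSignMean (V := V × BoundedSupport)
    (fun n => (σ n).prodMap (translate (drift n)))
    (by rw [hσ0, map_zero, BoundedSupport.translate_zero]; rfl)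
    (fun m n => by rw [hσ, map_add, translate_add]; rfl)
    (hδ.prod isSignMean_poissonMean)
    (fun n v => by simp [hinv, poissonMean_translate])
  simp only [AddMonoidHom.coe_prodMap, Prod.fst_sum, Prod.snd_sum, Prod.map_fst, Prod.map_snd,
    Finset.prod_mul_distrib] at hA
  refine ⟨A, mixingOrder_eq_one ?_ ?_, fun r n hn => ?_⟩
  · intro n _
    refine (hA 1 n).2 fun p => ?_
    simp [hinv, poissonMean_translate]
  · intro r hr
    have h := (hA (r + 2) _).1 (hr _ (movesApart_slowVector (r + 2)))
      fun i => (0, if (i : ℕ) < 2 then unitBlock else 0)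
    have hlim : Tendsto (fun j : ℕ => Real.exp (-(8 * |(√2 - 1) ^ j|))) atTop (𝓝 1) := by
      have h0 := tendsto_pow_atTop_nhds_zero_of_lt_one sqrt_two_sub_one_mem.1.le
        sqrt_two_sub_one_mem.2
      have := (Real.continuous_exp.tendsto _).comp ((h0.abs.const_mul 8).neg)
      simpa [Function.comp_def] using this
    have hle := le_of_tendsto_of_tendsto' hlim h fun j => by
      simp only [map_zero, Finset.sum_const_zero, hδ0, one_mul, Fin.sum_univ_succ]
      simpa [BoundedSupport.translate_zero, hδ0, drift_slowVector] using le_poissonMean_unitBlock ((√2 - 1) ^ j)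
    simp only [hδ0, Finset.prod_const_one, one_mul, Fin.prod_univ_succ] at hle
    simp [poissonMean_zero, poissonMean_unitBlock, ← Real.exp_add] at hle
    norm_num at hle
  · have hshape : IsMixingShape A.μ A.act n ↔ _ := hA r fun k i => (k : ℤ) • n i
    rw [hshape]
    have hdrift : ∀ (k : ℕ) i, drift ((k : ℤ) • n i) = k * drift (n i) := fun k i => by
      rw [map_zsmul, zsmul_eq_mul, Int.cast_natCast]
    refine ⟨fun h p => ?_, fun h p => ?_⟩
    · simpa [poissonMean_zero] using h fun i => (p i, 0)
    · refine (h fun i => (p i).1).mul (tendsto_const_nhds.congr' ?_)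
      filter_upwards [eventually_poissonMean_translate (drift_injective.comp hn)
        fun i => (p i).2] with k hk
      rw [← hk]
      simp only [hdrift, Function.comp_apply]

/-- There is a system without 2-mixing for which all shapes are mixing. -/
theorem exists_system_shapeOrder_top :
    ∃ A : MPSystem 2, A.mixOrder = 1 ∧ A.shapeOrder = ⊤ := by
  obtain ⟨A, h1, hA⟩ := exists_system_mixOrder_eq_one (V := Unit) (fun _ => AddMonoidHom.id _)
    rfl (fun _ _ => rfl) (isSignMean_one Unit) (fun _ _ => rfl) rfl
  refine ⟨A, h1, ENat.eq_top_iff_forall_ge.2 fun r => le_sSup ⟨r, fun n hn => ?_, rfl⟩⟩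
  exact (hA r n hn).2 fun p => by simp

/-- An algebraic relation between powers of two units of a field of characteristic two bounds
the shape order of mixing from above, and the absence of shorter recurring relations bounds it from
below. -/
theorem exists_system_shapeOrder_eq {K : Type} [Field K] [CharP K 2] (z y : Kˣ) (s : ℕ)
    (e : ℕ → ℤ) (hrel : ∑ i ∈ Finset.range (s + 1), ((z ^ e i * y ^ (i : ℤ) : Kˣ) : K) = 0)
    (hmix : ∀ n : Fin s → (Fin 2 → ℤ), Function.Injective n → ∀ a : Fin s → K, a ≠ 0 →
      ∀ᶠ k : ℕ in atTop, ∑ i, a i * ((z ^ n i 0 * y ^ n i 1 : Kˣ) : K) ^ k ≠ 0) :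
    ∃ A : MPSystem 2, A.mixOrder = 1 ∧ A.shapeOrder = s := by
  classical
  let _ : Algebra (ZMod 2) K := ZMod.algebra K 2
  let u : (Fin 2 → ℤ) → Kˣ := fun n => z ^ n 0 * y ^ n 1
  have hu0 : u 0 = 1 := by simp [u]
  have huadd : ∀ m n, u (m + n) = u m * u n := fun m n => by
    simp only [u, Pi.add_apply, zpow_add]
    exact mul_mul_mul_comm _ _ _ _
  have husmul : ∀ (k : ℕ) n, u ((k : ℤ) • n) = u n ^ k := fun k n => by
    simp [u, mul_pow, mul_comm (k : ℤ), zpow_mul]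
  obtain ⟨A, h1, hA⟩ := exists_system_mixOrder_eq_one (V := K)
    (fun n => AddMonoidHom.mulRight (u n : K)) (by ext; simp [hu0])
    (fun m n => by ext v; simp [huadd, mul_left_comm, mul_comm]) (isSignMean_haar K)
    (fun n v => by simp) (by simp)
  simp only [AddMonoidHom.mulRight_apply, husmul, Units.val_pow_eq_pow_val] at hA
  refine ⟨A, h1, le_antisymm (sSup_le ?_) (le_sSup ⟨s, fun n hn => ?_, rfl⟩)⟩
  · rintro _ ⟨r, hr, rfl⟩
    by_contra! hlt
    have hsr : s < r := by exact_mod_cast hlt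
    let n : Fin r → (Fin 2 → ℤ) := fun i => ![e i, i]
    have hn : Function.Injective n := fun i j hij => by
      have := congrFun hij 1
      simpa [n, Fin.ext_iff] using this
    have h := (hA r n hn).1 (hr n hn) fun i => if (i : ℕ) < s + 1 then 1 else 0
    have h' := h.comp (tendsto_pow_atTop_atTop_of_one_lt one_lt_two)
    have hsum : ∀ F : ℕ → K, ∑ i : Fin r, (if (i : ℕ) < s + 1 then 1 else 0) * F i =
        ∑ i ∈ Finset.range (s + 1), F i := fun F => by
      rw [Fin.sum_univ_eq_sum_range (fun i => (if i < s + 1 then 1 else 0) * F i) r]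
      simp only [ite_mul, one_mul, zero_mul]
      rw [← Finset.sum_filter]
      refine Finset.sum_congr ?_ fun _ _ => rfl
      ext i
      simp only [Finset.mem_filter, Finset.mem_range]
      omega
    have hone : ∀ m : ℕ, ∑ i : Fin r, (if (i : ℕ) < s + 1 then 1 else 0) *
        (u (n i) : K) ^ (2 ^ m) = 0 := fun m => by
      refine (hsum fun i => ((z ^ e i * y ^ (i : ℤ) : Kˣ) : K) ^ (2 ^ m)).trans ?_
      rw [← sum_pow_char_pow 2, hrel, zero_pow (by positivity)]
    have hprod : ∏ i : Fin r, (if (if (i : ℕ) < s + 1 then (1 : K) else 0) = 0 then (1 : ℝ) else 0)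
        = 0 :=
      Finset.prod_eq_zero (Finset.mem_univ ⟨0, by omega⟩) (by simp)
    rw [hprod] at h'
    refine one_ne_zero (tendsto_nhds_unique (tendsto_const_nhds.congr fun m => ?_) h')
    simp only [Function.comp_apply]
    rw [if_pos (hone m)]
  · refine (hA s n hn).2 fun a => ?_
    by_cases ha : a = 0
    · simp [ha]
    · obtain ⟨i, hi⟩ := Function.ne_iff.1 ha
      rw [Finset.prod_eq_zero (Finset.mem_univ i) (if_neg hi)]
      refine tendsto_const_nhds.congr' ?_
      filter_upwards [hmix n hn a ha] with k hk
      rw [if_neg hk]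

/-! ### Fields with prescribed shortest vanishing sums -/

/-- A weak form of Hensel's lemma: a root modulo `I` of a polynomial whose derivative there is
congruent to `1` lifts to a root in an `I`-adically complete ring. -/
theorem Polynomial.exists_root_sub_mem_of_isAdicComplete {R : Type*} [CommRing R] (I : Ideal R)
    [IsAdicComplete I R] (p : Polynomial R) (a₀ : R) (h₀ : p.eval a₀ ∈ I)
    (h₁ : p.derivative.eval a₀ - 1 ∈ I) : ∃ a, p.eval a = 0 ∧ a - a₀ ∈ I := by
  let c : ℕ → R := fun n ↦ Nat.rec a₀ (fun _ b ↦ b - p.eval b) n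
  have hc (n) : c (n + 1) = c n - p.eval (c n) := rfl
  have hc₀ (n) (hn : ∀ m < n, p.eval (c m) ∈ I) : c n - a₀ ∈ I := by
    induction n with
    | zero => simp [c]
    | succ n ih =>
      have := I.sub_mem (ih fun m hm ↦ hn m (hm.trans n.lt_succ_self)) (hn n n.lt_succ_self)
      rwa [sub_right_comm, ← hc] at this
  have hpc (n) : p.eval (c n) ∈ I ^ (n + 1) := by
    induction n using Nat.strong_induction_on with
    | _ n ih =>
    cases n with
    | zero => simpa [c] using h₀
    | succ n =>
      have hI (m) (hm : m < n + 1) : p.eval (c m) ∈ I := by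
        simpa using Ideal.pow_le_pow_right (Nat.le_add_left 1 m) (ih m hm)
      have hn := ih n n.lt_succ_self
      have hder : p.derivative.eval (c n) - 1 ∈ I := by
        have h := Ideal.mem_of_dvd I (p.derivative.sub_dvd_eval_sub (c n) a₀)
          (hc₀ n fun m hm ↦ hI m (hm.trans n.lt_succ_self))
        simpa using I.add_mem h h₁
      obtain ⟨k, hk⟩ := p.binomExpansion (c n) (-p.eval (c n))
      rw [← sub_eq_add_neg, ← hc] at hk
      have key : p.eval (c (n + 1)) = -((p.derivative.eval (c n) - 1) * p.eval (c n)) +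
          (k * p.eval (c n)) * p.eval (c n) := by rw [hk]; ring
      rw [key, pow_succ']
      exact add_mem (neg_mem (Ideal.mul_mem_mul hder hn))
        (Ideal.mul_mem_mul (I.mul_mem_left _ (hI n n.lt_succ_self)) hn)
  have hcauchy : ∀ {m n}, m ≤ n → c m ≡ c n [SMOD (I ^ m • ⊤ : Ideal R)] := by
    intro m n hmn
    rw [← Ideal.one_eq_top, Ideal.smul_eq_mul, mul_one]
    induction n, hmn using Nat.le_induction with
    | base => rfl
    | succ n hmn ih =>
      refine ih.trans ?_
      rw [hc, SModEq.sub_mem, sub_sub_cancel]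
      exact Ideal.pow_le_pow_right (by lia) (hpc n)
  obtain ⟨a, ha⟩ := IsPrecomplete.prec' c hcauchy
  simp only [← Ideal.one_eq_top, Ideal.smul_eq_mul, mul_one] at ha
  refine ⟨a, IsHausdorff.haus' (I := I) _ fun n ↦ ?_, ?_⟩
  · rw [← Ideal.one_eq_top, Ideal.smul_eq_mul, mul_one]
    refine ((ha n).symm.eval p).trans ?_
    rw [SModEq.zero]
    exact Ideal.pow_le_pow_right n.le_succ (hpc n)
  · have h := ha 1
    rw [pow_one, SModEq.sub_mem] at h
    have := I.sub_mem (hc₀ 1 fun m hm ↦ by obtain rfl : m = 0 := by lia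
                                           simpa [c] using h₀) h
    simpa using this

/-- If `∑ aᵢ uᵢ ^ k = 0` for infinitely many `k`, then the coefficients that do not vanish cannot
have a unique element `uᵢ` of smallest order in an embedding into Laurent series. -/
theorem exists_ne_order_minimal_of_frequently_sum_eq_zero {K F ι : Type*} [Field K] [Field F]
    [Fintype ι] (φ : K →+* LaurentSeries F) (u : ι → K) (hu : ∀ i, u i ≠ 0) (a : ι → K)
    (ha : a ≠ 0) (h : ∃ᶠ k : ℕ in atTop, ∑ i, a i * u i ^ k = 0) :
    ∃ i j, i ≠ j ∧ a i ≠ 0 ∧ a j ≠ 0 ∧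
      (∀ l, a l ≠ 0 → (φ (u i)).order ≤ (φ (u l)).order) ∧
      (∀ l, a l ≠ 0 → (φ (u j)).order ≤ (φ (u l)).order) := by
  classical
  obtain ⟨i₁, hi₁⟩ := Function.ne_iff.1 ha
  obtain ⟨i, hi, hmin⟩ := (Finset.univ.filter (a · ≠ 0)).exists_min_image
    (fun i ↦ (φ (u i)).order) ⟨i₁, by simpa using hi₁⟩
  simp only [Finset.mem_filter, Finset.mem_univ, true_and] at hi hmin
  by_contra! hcon
  have hlt (l) (hl : a l ≠ 0) (hne : i ≠ l) : (φ (u i)).order < (φ (u l)).order := by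
    obtain ⟨l', hl', hlt⟩ := hcon i l hne hi hl hmin
    exact (hmin l' hl').trans_lt hlt
  have hord (l) (hl : a l ≠ 0) (k : ℕ) :
      (φ (a l * u l ^ k)).order = (φ (a l)).order + k * (φ (u l)).order := by
    rw [map_mul, map_pow, HahnSeries.order_mul (by simpa using hl)
      (pow_ne_zero _ (by simpa using hu l)), HahnSeries.order_pow, nsmul_eq_mul]
  have hev : ∀ᶠ k : ℕ in atTop, ∀ l, a l ≠ 0 → i ≠ l →
      (φ (a i * u i ^ k)).order < (φ (a l * u l ^ k)).order := by
    refine eventually_all.2 fun l ↦ ?_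
    filter_upwards [eventually_gt_atTop ((φ (a i)).order - (φ (a l)).order).toNat] with k hk hl hne
    rw [hord i hi, hord l hl]
    have h₁ := hlt l hl hne
    have h₂ : (φ (a i)).order - (φ (a l)).order < k := Int.toNat_lt' (by lia) |>.1 hk
    nlinarith
  obtain ⟨k, hk, hlt⟩ := (h.and_eventually hev).exists
  have hcoeff := congrArg (fun f ↦ (φ f).coeff (φ (a i * u i ^ k)).order) hk
  simp only [map_sum, HahnSeries.coeff_sum, map_zero, HahnSeries.coeff_zero] at hcoeff
  rw [Finset.sum_eq_single i (fun l _ hne ↦ ?_) (by simp), HahnSeries.coeff_order_eq_zero] at hcoeff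
  · simp [hi, hu i] at hcoeff
  · by_cases hl : a l = 0
    · simp [hl]
    · exact HahnSeries.coeff_eq_zero_of_lt_order (hlt l hl hne.symm)

/-- Fewer than `s + 1` points in the plane cannot have `s` edges in their convex hull with distinct
normal directions `(1, dⱼ)`. -/
theorem not_forall_maximizers_of_strictMono {s : ℕ} (hs : 0 < s) (d : Fin s → ℤ)
    (hd : StrictMono d) (n : Fin s → Fin 2 → ℤ) (I : Set (Fin s)) :
    ¬ ∀ j, ∃ p ∈ I, ∃ q ∈ I, n p 1 < n q 1 ∧
      (∀ l ∈ I, n l 0 + d j * n l 1 ≤ n p 0 + d j * n p 1) ∧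
      (∀ l ∈ I, n l 0 + d j * n l 1 ≤ n q 0 + d j * n q 1) := by
  intro h
  choose p hp q hq hlt hmp hmq using h
  obtain ⟨m, rfl⟩ := Nat.exists_eq_succ_of_ne_zero hs.ne'
  have hstep (j j' : Fin (m + 1)) (hj : j < j') : n (q j) 1 ≤ n (p j') 1 := by
    have h₁ := hmq j _ (hp j')
    have h₂ := hmp j' _ (hq j)
    have := hd hj
    by_contra! hcon
    nlinarith
  let f : Fin (m + 2) → Fin (m + 1) := Fin.cons (p 0) q
  have hmono : StrictMono fun k ↦ n (f k) 1 := by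
    refine Fin.strictMono_iff_lt_succ.2 fun j ↦ ?_
    induction j using Fin.cases with
    | zero => exact hlt 0
    | succ j => exact (hstep _ _ j.castSucc_lt_succ).trans_lt (hlt _)
  have hinj : Function.Injective f := fun a b hab ↦ hmono.injective (by simp only [hab])
  simpa using Fintype.card_le_of_injective _ hinj

/-- The polynomial `∑ᵢ T ^ Eᵢ X ^ i` of degree `s` over `𝔽₂[T]`. -/
def newtonPolynomial (s : ℕ) (E : ℕ → ℕ) : Polynomial (Polynomial (ZMod 2)) :=
  ∑ i ∈ Finset.range (s + 1), Polynomial.C (Polynomial.X ^ E i) * Polynomial.X ^ i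

theorem newtonPolynomial_coeff {s : ℕ} {E : ℕ → ℕ} {i : ℕ} (hi : i ≤ s) :
    (newtonPolynomial s E).coeff i = Polynomial.X ^ E i := by
  rw [newtonPolynomial, Polynomial.finsetSum_coeff]
  simp only [Polynomial.coeff_C_mul_X_pow, Finset.sum_ite_eq, Finset.mem_range]
  rw [if_pos (by lia)]

theorem newtonPolynomial_natDegree_le (s : ℕ) (E : ℕ → ℕ) :
    (newtonPolynomial s E).natDegree ≤ s :=
  Polynomial.natDegree_sum_le_of_forall_le _ _ fun i hi ↦
    (Polynomial.natDegree_C_mul_X_pow_le _ _).trans (by simpa [Nat.lt_succ_iff] using hi)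

theorem newtonPolynomial_monic {s : ℕ} {E : ℕ → ℕ} (hE : E s = 0) :
    (newtonPolynomial s E).Monic :=
  Polynomial.monic_of_natDegree_le_of_coeff_eq_one s (newtonPolynomial_natDegree_le s E)
    (by rw [newtonPolynomial_coeff le_rfl, hE, pow_zero])

theorem newtonPolynomial_natDegree {s : ℕ} {E : ℕ → ℕ} (hE : E s = 0) :
    (newtonPolynomial s E).natDegree = s :=
  Polynomial.natDegree_eq_of_le_of_coeff_ne_zero (newtonPolynomial_natDegree_le s E)
    (by rw [newtonPolynomial_coeff le_rfl, hE, pow_zero]; exact one_ne_zero)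

theorem newtonPolynomial_irreducible {s : ℕ} (hs : 0 < s) {E : ℕ → ℕ} (hE : E s = 0)
    (h0 : E 0 = 1) (hpos : ∀ i < s, 0 < E i) : Irreducible (newtonPolynomial s E) := by
  have hprime : (Ideal.span {(Polynomial.X : Polynomial (ZMod 2))}).IsPrime :=
    (Ideal.span_singleton_prime Polynomial.X_ne_zero).2 Polynomial.prime_X
  refine Polynomial.IsEisensteinAt.irreducible ⟨?_, fun {i} hi ↦ ?_, ?_⟩ hprime
    (newtonPolynomial_monic hE).isPrimitive (by rwa [newtonPolynomial_natDegree hE])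
  · rw [newtonPolynomial_monic hE]
    exact fun h ↦ hprime.ne_top ((Ideal.eq_top_iff_one _).2 h)
  · rw [newtonPolynomial_natDegree hE] at hi
    rw [newtonPolynomial_coeff hi.le, Ideal.mem_span_singleton]
    exact dvd_pow_self _ (hpos i hi).ne'
  · rw [newtonPolynomial_coeff hs.le, h0, Ideal.span_singleton_pow, Ideal.mem_span_singleton,
      pow_dvd_pow_iff Polynomial.X_ne_zero Polynomial.not_isUnit_X]
    decide

/-- If `M` is the maximum of `E i + d * i`, attained exactly at `j` and `j + 1`, then the polynomial
`∑ᵢ T ^ Eᵢ X ^ i` has a root of order `-d` in the field of Laurent series in `T⁻¹`. -/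
theorem exists_newtonPolynomial_root {s : ℕ} {E : ℕ → ℕ} {j : ℕ} (hj : j < s) (d : ℤ)
    (heq : (E j : ℤ) + d * j = E (j + 1) + d * (j + 1))
    (hlt : ∀ i ≤ s, i ≠ j → i ≠ j + 1 → (E i : ℤ) + d * i < E j + d * j) :
    ∃ v : LaurentSeries (ZMod 2), v.order = -d ∧
      ∑ i ∈ Finset.range (s + 1), HahnSeries.single (-1 : ℤ) (1 : ZMod 2) ^ E i * v ^ i = 0 := by
  let M : ℤ := E j + d * j
  let b : ℕ → ℕ := fun i ↦ (M - (E i + d * i)).toNat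
  have hb (i) (hi : i ≤ s) : (b i : ℤ) = M - (E i + d * i) := by
    refine Int.toNat_of_nonneg ?_
    by_cases h₁ : i = j
    · subst h₁; simp [M]
    by_cases h₂ : i = j + 1
    · subst h₂; simp [M, heq]
    exact sub_nonneg.2 (hlt i hi h₁ h₂).le
  have hb₀ : b j = 0 := by simp [b, M]
  have hb₁ : b (j + 1) = 0 := by simp [b, M, heq]
  have hbpos (i) (hi : i ≤ s) (h₁ : i ≠ j) (h₂ : i ≠ j + 1) : b i ≠ 0 := by
    have h₃ := hb i hi
    have h₄ := hlt i hi h₁ h₂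
    simp only [M] at h₃
    lia
  let I : Ideal (PowerSeries (ZMod 2)) := .span {PowerSeries.X}
  let p : Polynomial (PowerSeries (ZMod 2)) :=
    ∑ i ∈ Finset.range (s + 1), Polynomial.C (PowerSeries.X ^ b i) * Polynomial.X ^ i
  have htwo : (2 : PowerSeries (ZMod 2)) = 0 := by
    rw [← map_ofNat (PowerSeries.C (R := ZMod 2)) 2]
    exact (congrArg _ (CharTwo.two_eq_zero (R := ZMod 2))).trans (map_zero _)
  have hsum (f : ℕ → PowerSeries (ZMod 2)) :
      ∑ i ∈ Finset.range (s + 1), PowerSeries.X ^ b i * f i - (f j + f (j + 1)) ∈ I := by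
    rw [← Finset.add_sum_erase _ _ (show j ∈ Finset.range (s + 1) by simp; lia),
      ← Finset.add_sum_erase _ _ (show j + 1 ∈ (Finset.range (s + 1)).erase j by simp; lia),
      hb₀, hb₁, pow_zero, one_mul, one_mul, ← add_assoc, add_sub_cancel_left]
    refine Ideal.sum_mem _ fun i hi ↦ I.mul_mem_right _ (Ideal.pow_mem_of_mem _
      (Ideal.mem_span_singleton_self _) _ (Nat.pos_of_ne_zero ?_))
    simp only [Finset.mem_erase, Finset.mem_range] at hi
    exact hbpos i (by lia) hi.2.1 hi.1
  obtain ⟨w, hw, hw1⟩ := p.exists_root_sub_mem_of_isAdicComplete I 1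
    (by
      have := hsum fun _ ↦ 1
      rw [one_add_one_eq_two, htwo, sub_zero] at this
      simpa [p, Polynomial.eval_finsetSum] using this)
    (by
      have := hsum fun i ↦ i
      have h₂ : ((j : PowerSeries (ZMod 2)) + (j + 1 : ℕ)) = 1 := by
        push_cast
        linear_combination (j : PowerSeries (ZMod 2)) * htwo
      rw [h₂] at this
      simpa only [p, Polynomial.derivative_sum, Polynomial.derivative_C_mul_X_pow,
        Polynomial.eval_finsetSum, Polynomial.eval_mul, Polynomial.eval_C, Polynomial.eval_pow,
        Polynomial.eval_X, one_pow, mul_one] using this)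
  have hwc : PowerSeries.constantCoeff w = 1 := by
    rw [Ideal.mem_span_singleton, PowerSeries.X_dvd_iff, map_sub, map_one, sub_eq_zero] at hw1
    exact hw1
  let W : LaurentSeries (ZMod 2) := HahnSeries.ofPowerSeries ℤ (ZMod 2) w
  have hW0 : W.coeff 0 = 1 := by
    have := HahnSeries.ofPowerSeries_apply_coeff (Γ := ℤ) w 0
    simpa [W, hwc] using this
  have hW : W ≠ 0 := by
    intro h
    simp [h] at hW0
  have hWord : W.order = 0 := by
    refine le_antisymm (HahnSeries.order_le_of_coeff_ne_zero (by simp [hW0])) ?_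
    refine (HahnSeries.le_order_iff_forall hW).2 fun k hk ↦ ?_
    exact HahnSeries.embDomain_of_notMem_range (by rintro ⟨n, rfl⟩; simp at hk; lia)
  have hne : HahnSeries.single (-d) (1 : ZMod 2) ≠ 0 := HahnSeries.single_ne_zero one_ne_zero
  refine ⟨HahnSeries.single (-d) 1 * W, ?_, ?_⟩
  · rw [HahnSeries.order_mul hne hW, hWord, HahnSeries.order_single one_ne_zero, add_zero]
  · have hterm (i) (hi : i ∈ Finset.range (s + 1)) :
        HahnSeries.single (-1 : ℤ) (1 : ZMod 2) ^ E i * (HahnSeries.single (-d) 1 * W) ^ i =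
          HahnSeries.single (-M) 1 * HahnSeries.ofPowerSeries ℤ (ZMod 2)
            (PowerSeries.X ^ b i * w ^ i) := by
      rw [map_mul, HahnSeries.ofPowerSeries_X_pow, map_pow, mul_pow, ← mul_assoc, ← mul_assoc,
        HahnSeries.single_pow, HahnSeries.single_pow, HahnSeries.single_mul_single,
        HahnSeries.single_mul_single, hb i (by simpa [Nat.lt_succ_iff] using hi)]
      simp only [one_pow, mul_one, nsmul_eq_mul, W]
      congr 2
      ring_nf
    rw [Finset.sum_congr rfl hterm, ← Finset.mul_sum, ← map_sum]
    have : ∑ i ∈ Finset.range (s + 1), PowerSeries.X ^ b i * w ^ i = 0 := by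
      rw [← hw]
      simp [p, Polynomial.eval_finsetSum]
    rw [this, map_zero, mul_zero]

/-- Evaluation of polynomials over `𝔽₂` at the inverse of the variable of the Laurent series. -/
def evalAtInverse : Polynomial (ZMod 2) →+* LaurentSeries (ZMod 2) :=
  Polynomial.eval₂RingHom HahnSeries.C (HahnSeries.single (-1) 1)

theorem evalAtInverse_X : evalAtInverse Polynomial.X = HahnSeries.single (-1) 1 :=
  Polynomial.eval₂_X _ _

theorem evalAtInverse_injective : Function.Injective evalAtInverse := by
  refine (injective_iff_map_eq_zero _).2 fun p hp ↦ ?_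
  ext n
  have h := congrArg (fun f ↦ f.coeff (-n : ℤ)) hp
  simp only [evalAtInverse, Polynomial.coe_eval₂RingHom, Polynomial.eval₂_eq_sum,
    Polynomial.sum, HahnSeries.coeff_sum, HahnSeries.single_pow, HahnSeries.C_mul_eq_smul, HahnSeries.coeff_smul,
    HahnSeries.coeff_single, HahnSeries.coeff_zero, one_pow] at h
  simpa [eq_comm, HahnSeries.coeff_single] using h

theorem exists_extension_evalAtInverse (F : Type*) [Field F] [Algebra (Polynomial (ZMod 2)) F]
    [IsFractionRing (Polynomial (ZMod 2)) F] :
    ∃ ψ : F →+* LaurentSeries (ZMod 2), ψ.comp (algebraMap _ F) = evalAtInverse :=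
  ⟨IsLocalization.lift (M := nonZeroDivisors (Polynomial (ZMod 2))) fun p ↦
      ((map_ne_zero_iff _ evalAtInverse_injective).2 (nonZeroDivisors.coe_ne_zero p)).isUnit,
    IsLocalization.lift_comp _⟩

theorem newtonPolynomial_eval₂ {A : Type*} [CommSemiring A] (s : ℕ) (E : ℕ → ℕ)
    (f : Polynomial (ZMod 2) →+* A) (v : A) :
    (newtonPolynomial s E).eval₂ f v =
      ∑ i ∈ Finset.range (s + 1), f Polynomial.X ^ E i * v ^ i := by
  simp only [newtonPolynomial, Polynomial.eval₂_finsetSum, Polynomial.eval₂_mul,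
    Polynomial.eval₂_C, Polynomial.eval₂_X_pow, map_pow f]

/-- The adjunction of a root of the polynomial `∑ᵢ T ^ Eᵢ X ^ i` to the field of fractions of
`𝔽₂[T]`, with its embeddings in Laurent series. -/
theorem exists_adjoinRoot_embeddings (F : Type) [Field F] [Algebra (Polynomial (ZMod 2)) F]
    [IsFractionRing (Polynomial (ZMod 2)) F] {s : ℕ} (hs : 0 < s) {E : ℕ → ℕ} (hE : E s = 0)
    (h0 : E 0 = 1)
    (hpos : ∀ i < s, 0 < E i) (d : Fin s → ℤ)
    (heq : ∀ j : Fin s, (E j : ℤ) + d j * j = E (j + 1) + d j * (j + 1))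
    (hlt : ∀ j : Fin s, ∀ i ≤ s, i ≠ j → i ≠ j + 1 → (E i : ℤ) + d j * i < E j + d j * j) :
    ∃ (K : Type) (_ : Field K) (_ : CharP K 2) (z y : Kˣ),
      ∑ i ∈ Finset.range (s + 1), (z : K) ^ E i * (y : K) ^ i = 0 ∧
      ∀ j, ∃ φ : K →+* LaurentSeries (ZMod 2), (φ z).order = -1 ∧ (φ y).order = -d j := by
  obtain ⟨Q, hQP⟩ : ∃ Q, Q = (newtonPolynomial s E).map (algebraMap _ F) := ⟨_, rfl⟩
  have hQ : Irreducible Q := hQP ▸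
    (newtonPolynomial_monic hE).irreducible_iff_irreducible_map_fraction_map.1
      (newtonPolynomial_irreducible hs hE h0 hpos)
  have : Fact (Irreducible Q) := ⟨hQ⟩
  have hev {A : Type} [CommSemiring A] (g : F →+* A) (v : A) : Q.eval₂ g v =
      ∑ i ∈ Finset.range (s + 1), g (algebraMap (Polynomial (ZMod 2)) F Polynomial.X) ^ E i * v ^ i := by
    rw [hQP, Polynomial.eval₂_map, newtonPolynomial_eval₂]
    rfl
  let θ : Polynomial (ZMod 2) →+* AdjoinRoot Q := (AdjoinRoot.of Q).comp (algebraMap _ F)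
  have hθ : Function.Injective θ :=
    (AdjoinRoot.of Q).injective.comp (IsFractionRing.injective _ _)
  have hchar : CharP (AdjoinRoot Q) 2 := charP_of_injective_ringHom hθ 2
  have hz : θ Polynomial.X ≠ 0 := (map_ne_zero_iff θ hθ).2 Polynomial.X_ne_zero
  have hrel : ∑ i ∈ Finset.range (s + 1), θ Polynomial.X ^ E i * AdjoinRoot.root Q ^ i = 0 := by
    have h := AdjoinRoot.eval₂_root Q
    rwa [hev] at h
  have hy : AdjoinRoot.root Q ≠ 0 := by
    intro h
    rw [h, Finset.sum_eq_single 0 (fun i _ hi ↦ by rw [zero_pow hi, mul_zero]) (by simp)] at hrel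
    simp [hz] at hrel
  refine ⟨AdjoinRoot Q, inferInstance, hchar, Units.mk0 _ hz, Units.mk0 _ hy, hrel, fun j ↦ ?_⟩
  obtain ⟨v, hvd, hv⟩ := exists_newtonPolynomial_root j.2 (d j) (heq j) (hlt j)
  obtain ⟨ψ, hψ⟩ := exists_extension_evalAtInverse F
  have hroot : Q.eval₂ ψ v = 0 := by
    rwa [hev, ← RingHom.comp_apply, hψ, evalAtInverse_X]
  refine ⟨AdjoinRoot.lift ψ v hroot, ?_, ?_⟩
  · have : AdjoinRoot.lift ψ v hroot (θ Polynomial.X) = HahnSeries.single (-1) 1 := by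
      rw [← evalAtInverse_X, ← hψ]
      simp [θ]
    rw [Units.val_mk0, this, HahnSeries.order_single one_ne_zero]
  · rw [Units.val_mk0, AdjoinRoot.lift_root, hvd]

theorem LaurentSeries.order_zpow {F : Type*} [Field F] {x : LaurentSeries F} (hx : x ≠ 0) (n : ℤ) :
    (x ^ n).order = n * x.order := by
  cases n with
  | ofNat n => simp [HahnSeries.order_pow]
  | negSucc n =>
    have h := HahnSeries.order_mul (inv_ne_zero (pow_ne_zero (n + 1) hx)) (pow_ne_zero (n + 1) hx)
    rw [inv_mul_cancel₀ (pow_ne_zero _ hx), HahnSeries.order_one, HahnSeries.order_pow,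
      nsmul_eq_mul] at h
    rw [zpow_negSucc, Int.negSucc_eq]
    push_cast at h ⊢
    linear_combination -h

/-- Embeddings into Laurent series in which `y` has strictly monotone order relative to `z` exclude
vanishing sums of at most `s` monomials in `z` and `y` along infinitely many powers. -/
theorem eventually_sum_ne_zero_of_embeddings {K F : Type*} [Field K] [Field F] {s : ℕ}
    (hs : 0 < s) (z y : Kˣ) (d : Fin s → ℤ) (hd : StrictMono d)
    (hφ : ∀ j, ∃ φ : K →+* LaurentSeries F, (φ z).order = -1 ∧ (φ y).order = -d j)
    (n : Fin s → Fin 2 → ℤ) (hn : Function.Injective n) (a : Fin s → K) (ha : a ≠ 0) :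
    ∀ᶠ k : ℕ in atTop, ∑ i, a i * ((z ^ n i 0 * y ^ n i 1 : Kˣ) : K) ^ k ≠ 0 := by
  by_contra hcon
  have hfreq : ∃ᶠ k : ℕ in atTop, ∑ i, a i * ((z ^ n i 0 * y ^ n i 1 : Kˣ) : K) ^ k = 0 := by
    simpa only [not_eventually, not_not] using hcon
  refine not_forall_maximizers_of_strictMono hs d hd n {i | a i ≠ 0} fun j ↦ ?_
  obtain ⟨φ, hz, hy⟩ := hφ j
  have hord (i) : (φ ((z ^ n i 0 * y ^ n i 1 : Kˣ) : K)).order = -(n i 0 + d j * n i 1) := by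
    have hz0 : φ z ≠ 0 := by simp
    have hy0 : φ y ≠ 0 := by simp
    rw [Units.val_mul, Units.val_zpow_eq_zpow_val, Units.val_zpow_eq_zpow_val, map_mul, map_zpow₀,
      map_zpow₀, HahnSeries.order_mul (zpow_ne_zero _ hz0) (zpow_ne_zero _ hy0),
      LaurentSeries.order_zpow hz0, LaurentSeries.order_zpow hy0, hz, hy]
    ring
  obtain ⟨p, q, hpq, hp, hq, hmp, hmq⟩ := exists_ne_order_minimal_of_frequently_sum_eq_zero φ
    (fun i ↦ ((z ^ n i 0 * y ^ n i 1 : Kˣ) : K)) (fun i ↦ Units.ne_zero _) a ha hfreq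
  simp only [hord, neg_le_neg_iff] at hmp hmq
  have heq := le_antisymm (hmq p hp) (hmp q hq)
  have hne : n p 1 ≠ n q 1 := by
    refine fun h ↦ hpq (hn (funext fun i ↦ ?_))
    fin_cases i
    · simpa [h] using heq
    · exact h
  rcases hne.lt_or_gt with h | h
  · exact ⟨p, hp, q, hq, h, hmp, hmq⟩
  · exact ⟨q, hq, p, hp, h, hmq, hmp⟩

/-- The exponents of the coefficients of a polynomial of degree `s` whose Newton polygon has `s`
edges of different slopes. -/
def newtonExponent (s i : ℕ) : ℕ := if i < s then 1 + i * (s - i) else 0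

/-- The slopes of the Newton polygon with vertices at `newtonExponent s i`. -/
def newtonSlope (s : ℕ) (j : Fin s) : ℤ := newtonExponent s j - newtonExponent s (j + 1)

theorem newtonExponent_of_lt {s i : ℕ} (hi : i < s) :
    (newtonExponent s i : ℤ) = 1 + i * (s - i) := by
  rw [newtonExponent, if_pos hi]
  push_cast [hi.le]
  rfl

theorem newtonExponent_self (s : ℕ) : newtonExponent s s = 0 := by simp [newtonExponent]

theorem newtonSlope_of_lt {s : ℕ} {j : Fin s} (hj : (j : ℕ) + 1 < s) :
    newtonSlope s j = 2 * j + 1 - s := by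
  rw [newtonSlope, newtonExponent_of_lt j.2, newtonExponent_of_lt hj]
  push_cast
  ring

theorem newtonSlope_last {s : ℕ} {j : Fin s} (hj : (j : ℕ) + 1 = s) : newtonSlope s j = s := by
  rw [newtonSlope, hj, newtonExponent_self, newtonExponent_of_lt j.2]
  have hs : (s : ℤ) = j + 1 := by lia
  rw [hs]
  push_cast
  ring

theorem newtonSlope_strictMono (s : ℕ) : StrictMono (newtonSlope s) := by
  intro i j hij
  have hij' : (i : ℕ) < j := hij
  rw [newtonSlope_of_lt (by lia : (i : ℕ) + 1 < s)]
  rcases (Nat.succ_le_of_lt j.2).lt_or_eq with h | h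
  · rw [newtonSlope_of_lt h]
    lia
  · rw [newtonSlope_last h]
    lia

theorem newtonExponent_add_slope_lt {s : ℕ} (j : Fin s) {i : ℕ} (hi : i ≤ s) (h₁ : i ≠ j)
    (h₂ : i ≠ j + 1) :
    (newtonExponent s i : ℤ) + newtonSlope s j * i <
      newtonExponent s j + newtonSlope s j * j := by
  have hprod : 0 < ((i : ℤ) - j) * (i - j - 1) := by
    rcases h₁.lt_or_gt with h | h
    · exact mul_pos_of_neg_of_neg (by lia) (by lia)
    · exact mul_pos (by lia) (by lia)
  rw [newtonExponent_of_lt j.2]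
  rcases (Nat.succ_le_of_lt j.2).lt_or_eq with hj | hj
  · rw [newtonSlope_of_lt hj]
    rcases hi.lt_or_eq with hi | rfl
    · rw [newtonExponent_of_lt hi]
      linear_combination hprod
    · rw [newtonExponent_self]
      linear_combination hprod
  · rw [newtonSlope_last hj, newtonExponent_of_lt (by lia)]
    have hs : (s : ℤ) = j + 1 := by lia
    rw [hs]
    nlinarith

theorem exists_system_shapeOrder_natCast {s : ℕ} (hs : 0 < s) :
    ∃ A : MPSystem 2, A.mixOrder = 1 ∧ A.shapeOrder = s := by
  obtain ⟨K, _, _, z, y, hrel, hφ⟩ := exists_adjoinRoot_embeddings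
    (FractionRing (Polynomial (ZMod 2))) hs (newtonExponent_self s)
    (by simp [newtonExponent, hs]) (fun i hi ↦ by simp [newtonExponent, hi]) (newtonSlope s)
    (fun j ↦ by rw [newtonSlope]; ring) (fun j i ↦ newtonExponent_add_slope_lt j)
  refine exists_system_shapeOrder_eq z y s (fun i ↦ newtonExponent s i) ?_
    (eventually_sum_ne_zero_of_embeddings hs z y _ (newtonSlope_strictMono s) hφ)
  simpa using hrel

/-- For every `s` with `1 ≤ s ≤ ∞` there is a measure-preserving
`ℤ²`-action with `M(α) = 1` and `S(α) = s`. -/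
theorem exists_system_with_prescribed_shape_order :
    ∀ s : ℕ∞, 1 ≤ s → ∃ A : MPSystem 2, A.mixOrder = 1 ∧ A.shapeOrder = s := by
  intro s hs
  induction s using ENat.recTopCoe with
  | top => exact exists_system_shapeOrder_top
  | coe m => exact exists_system_shapeOrder_natCast (by exact_mod_cast hs)
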